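/- Let P be a connected patch contained in some tiling of Ω and let t₁, t₂ ∈ P. Then V(P, t₁, t₂) is equal to a finite composition (as relations on Ω_punc) of relations of the form V({s, s'}, s, s'), where each {s, s'} is a pair of adjacent tiles of P, together with their transposes. -/

import Mathlib

open Metric Set Pointwise

noncomputable section

/-- Points of `ℝ^d`. -/
abbrev Pt (d : ℕ) := EuclideanSpace ℝ (Fin d)

/-- A (possibly labelled) tile in `ℝ^d`: a subset of `ℝ^d` together with a label. -/
structure Tile (d : ℕ) where
  carrier : Set (Pt d)
  label : ℕ

instance {d : ℕ} : Inhabited (Tile d) := ⟨⟨∅, 0⟩⟩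

/-- Translate of a tile by a vector. -/
def Tile.translate {d : ℕ} (t : Tile d) (x : Pt d) : Tile d :=
  ⟨(fun y => y + x) '' t.carrier, t.label⟩

/-- A tile proper: homeomorphic to the closed unit ball. -/
def Tile.IsTile {d : ℕ} (t : Tile d) : Prop :=
  Nonempty (t.carrier ≃ₜ (Metric.closedBall (0 : Pt d) 1))

/-- Support of a partial tiling: the union of its tiles. -/
def psupp {d : ℕ} (P : Set (Tile d)) : Set (Pt d) := ⋃ t ∈ P, t.carrier

/-- `tilesAt P U` = the tiles of `P` meeting `U`, written `P(U)` in the paper. -/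
def tilesAt {d : ℕ} (P : Set (Tile d)) (U : Set (Pt d)) : Set (Tile d) :=
  {t ∈ P | (t.carrier ∩ U).Nonempty}

/-- Translate of a collection of tiles. -/
def translateSet {d : ℕ} (P : Set (Tile d)) (x : Pt d) : Set (Tile d) :=
  (fun t => t.translate x) '' P

/-- A partial tiling: tiles with pairwise disjoint interiors. -/
def IsPartialTiling {d : ℕ} (P : Set (Tile d)) : Prop :=
  (∀ t ∈ P, t.IsTile) ∧
  ∀ t ∈ P, ∀ t' ∈ P, t ≠ t' → interior t.carrier ∩ interior t'.carrier = ∅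

/-- A patch: a finite partial tiling. -/
def IsPatch {d : ℕ} (P : Set (Tile d)) : Prop := IsPartialTiling P ∧ P.Finite

/-- A tiling of all of `ℝ^d`. -/
def IsTilingOfSpace {d : ℕ} (P : Set (Tile d)) : Prop :=
  IsPartialTiling P ∧ psupp P = univ

/-- A substitution tiling system `(𝒫, ω)` with inflation constant `λ > 1`. -/
structure SubstSystem (d : ℕ) where
  proto : Set (Tile d)
  proto_finite : proto.Finite
  proto_nonempty : proto.Nonempty
  proto_isTile : ∀ p ∈ proto, p.IsTile
  proto_zero_mem : ∀ p ∈ proto, (0 : Pt d) ∈ interior p.carrier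
  proto_no_translate : ∀ p ∈ proto, ∀ q ∈ proto, ∀ x : Pt d,
    q = p.translate x → p = q ∧ x = 0
  lam : ℝ
  one_lt_lam : 1 < lam
  sub : Tile d → Set (Tile d)
  sub_patch : ∀ p ∈ proto, IsPatch (sub p)
  sub_proto : ∀ p ∈ proto, ∀ t ∈ sub p, ∃ q ∈ proto, ∃ x : Pt d, t = q.translate x
  sub_supp : ∀ p ∈ proto, psupp (sub p) = lam • p.carrier
  sub_translate : ∀ (t : Tile d) (x : Pt d),
    sub (t.translate x) = (fun s => s.translate (lam • x)) '' sub t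

namespace SubstSystem

variable {d : ℕ} (S : SubstSystem d)

/-- Tile-wise application of the substitution to a collection of tiles. -/
def subSet (P : Set (Tile d)) : Set (Tile d) := ⋃ t ∈ P, S.sub t

/-- Iterated substitution `ω^n` on collections of tiles. -/
def subIter (n : ℕ) (P : Set (Tile d)) : Set (Tile d) := (S.subSet)^[n] P

/-- `ω^n(t)` for a single tile `t`. -/
def omegan (n : ℕ) (t : Tile d) : Set (Tile d) := S.subIter n {t}

/-- The continuous hull `Ω`. -/
def Omega : Set (Set (Tile d)) :=
  {T | IsTilingOfSpace T ∧ ∀ P : Set (Tile d), P ⊆ T → IsPatch P →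
    ∃ n : ℕ, ∃ p ∈ S.proto, ∃ x : Pt d, P ⊆ translateSet (S.omegan n p) x}

/-- `x` is the puncture of the tile `t`, i.e. `t = p + x` for a prototile `p`. -/
def IsPuncture (t : Tile d) (x : Pt d) : Prop :=
  ∃ p ∈ S.proto, t = p.translate x

open Classical in
/-- The puncture `x(t)` of a tile `t` (chosen; unique for translates of prototiles). -/
def punc (t : Tile d) : Pt d :=
  if h : ∃ x : Pt d, S.IsPuncture t x then h.choose else 0

/-- The punctured hull (transversal) `Ω_punc`. -/
def OmegaPunc : Set (Set (Tile d)) :=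
  {T ∈ S.Omega | ∃ t ∈ T, S.IsPuncture t 0}

end SubstSystem

/-- The tiling metric. -/
def tilingDist {d : ℕ} (T T' : Set (Tile d)) : ℝ :=
  sInf ({1} ∪ {ε : ℝ | 0 < ε ∧ ∃ x x' : Pt d, ‖x‖ < ε ∧ ‖x'‖ < ε ∧
    tilesAt (translateSet T (-x)) (ball (0 : Pt d) (1 / ε)) =
      tilesAt (translateSet T' (-x')) (ball (0 : Pt d) (1 / ε))})

namespace SubstSystem

variable {d : ℕ} (S : SubstSystem d)

/-- Density of a family of tilings in `Ω_punc` w.r.t. the tiling metric. -/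
def DenseInPunc (E : Set (Set (Tile d))) : Prop :=
  ∀ T ∈ S.OmegaPunc, ∀ ε : ℝ, 0 < ε → ∃ T' ∈ E, tilingDist T T' < ε

/-- Openness of a subset of `Ω_punc` w.r.t. the tiling metric (subspace topology). -/
def OpenInPunc (E : Set (Set (Tile d))) : Prop :=
  E ⊆ S.OmegaPunc ∧ ∀ T ∈ E, ∃ ε : ℝ, 0 < ε ∧
    ∀ T' ∈ S.OmegaPunc, tilingDist T T' < ε → T' ∈ E

/-- The translational equivalence relation `R_punc` on `Ω_punc`. -/
def Rpunc : Set (Set (Tile d) × Set (Tile d)) :=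
  {TT | TT.1 ∈ S.OmegaPunc ∧ TT.2 ∈ S.OmegaPunc ∧ ∃ x : Pt d, TT.2 = translateSet TT.1 x}

/-- `Punc(n, p)`: the punctures of the tiles of `ω^n(p)`. -/
def Punc (n : ℕ) (p : Tile d) : Set (Pt d) :=
  {x | ∃ t ∈ S.omegan n p, S.IsPuncture t x}

/-- `E^n_p(x, y)`. -/
def Eset (n : ℕ) (p : Tile d) (x y : Pt d) : Set (Set (Tile d) × Set (Tile d)) :=
  {TT | ∃ T ∈ S.OmegaPunc, p ∈ T ∧
    TT.1 = translateSet (S.subIter n T) (-x) ∧ TT.2 = translateSet (S.subIter n T) (-y)}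

/-- `R_n`. -/
def Rn (n : ℕ) : Set (Set (Tile d) × Set (Tile d)) :=
  ⋃ p ∈ S.proto, ⋃ x ∈ S.Punc n p, ⋃ y ∈ S.Punc n p, S.Eset n p x y

/-- `R_AF = ∪ₙ R_n`. -/
def RAF : Set (Set (Tile d) × Set (Tile d)) := ⋃ n : ℕ, S.Rn n

/-- `U(P, t)`. -/
def Uset (P : Set (Tile d)) (t : Tile d) : Set (Set (Tile d)) :=
  {T ∈ S.OmegaPunc | translateSet P (-(S.punc t)) ⊆ T}

/-- `V(P, t₁, t₂)`. -/
def Vset (P : Set (Tile d)) (t₁ t₂ : Tile d) : Set (Set (Tile d) × Set (Tile d)) :=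
  {TT | TT.1 ∈ S.Uset P t₁ ∧ TT.2 = translateSet TT.1 (S.punc t₁ - S.punc t₂)}

/-- (A1) primitivity. -/
def Primitive : Prop :=
  ∃ N : ℕ, ∀ p ∈ S.proto, ∀ q ∈ S.proto, ∃ x : Pt d, Tile.translate q x ∈ S.omegan N p

/-- (A2) finite local complexity. -/
def FLC : Prop :=
  ∀ R : ℝ, 0 < R → ∃ Ps : Set (Set (Tile d)), Ps.Finite ∧
    ∀ P : Set (Tile d), IsPatch P → Metric.diam (psupp P) < R →
      (∃ T ∈ S.Omega, P ⊆ T) → ∃ P₀ ∈ Ps, ∃ x : Pt d, P = translateSet P₀ x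

/-- (A3) `ω : Ω → Ω` is bijective. -/
def SubBijective : Prop := Set.BijOn S.subSet S.Omega S.Omega

/-- (A4) `ω` forces its border. -/
def ForcesBorder : Prop :=
  ∃ n : ℕ, ∀ p ∈ S.proto, ∀ T ∈ S.Omega, ∀ T' ∈ S.Omega, ∀ x x' : Pt d,
    translateSet (S.omegan n p) x ⊆ T → translateSet (S.omegan n p) x' ⊆ T' →
    translateSet (tilesAt T ((fun y => y + x) '' psupp (S.omegan n p))) (-x) =
      translateSet (tilesAt T' ((fun y => y + x') '' psupp (S.omegan n p))) (-x')

/-- Prototile boundaries have box-counting dimension strictly less than `d`. -/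
def SmallBoundary : Prop :=
  ∃ c : ℝ, c < d ∧ ∃ K₀ : ℝ, ∀ p ∈ S.proto, ∀ ε : ℝ, 0 < ε →
    ∃ centers : Finset (Pt d), (centers.card : ℝ) ≤ K₀ * ε ^ (-c) ∧
      frontier p.carrier ⊆ ⋃ z ∈ centers, ball z ε

end SubstSystem

/-- A symmetry group action for `(𝒫, ω)`: `G ≤ O(d, ℝ)` acting on tiles, preserving
the prototile set and commuting with the substitution. -/
structure SymmAction {d : ℕ} (S : SubstSystem d) (G : Subgroup (Pt d ≃ₗᵢ[ℝ] Pt d)) where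
  act : G → Tile d → Tile d
  act_carrier : ∀ (g : G) (t : Tile d),
    (act g t).carrier = (g : Pt d ≃ₗᵢ[ℝ] Pt d) '' t.carrier
  act_one : ∀ t : Tile d, act 1 t = t
  act_mul : ∀ (g h : G) (t : Tile d), act (g * h) t = act g (act h t)
  act_proto : ∀ (g : G), ∀ p ∈ S.proto, act g p ∈ S.proto
  act_translate : ∀ (g : G) (t : Tile d) (x : Pt d),
    act g (t.translate x) = (act g t).translate ((g : Pt d ≃ₗᵢ[ℝ] Pt d) x)
  act_sub : ∀ (g : G), ∀ p ∈ S.proto, S.sub (act g p) = act g '' S.sub p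

/-- Action of a group element on a (partial) tiling: `gT = {gt : t ∈ T}`. -/
def SymmAction.actSet {d : ℕ} {S : SubstSystem d} {G : Subgroup (Pt d ≃ₗᵢ[ℝ] Pt d)}
    (σ : SymmAction S G) (g : G) (T : Set (Tile d)) : Set (Tile d) := σ.act g '' T

/-- `G` acts freely on the prototile set. -/
def SymmAction.FreeOnProto {d : ℕ} {S : SubstSystem d} {G : Subgroup (Pt d ≃ₗᵢ[ℝ] Pt d)}
    (σ : SymmAction S G) : Prop := ∀ g : G, ∀ p ∈ S.proto, σ.act g p = p → g = 1

/-- Composition of relations. -/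
def relComp {α : Type*} (R₁ R₂ : Set (α × α)) : Set (α × α) :=
  {q | ∃ z : α, (q.1, z) ∈ R₁ ∧ (z, q.2) ∈ R₂}

/-- Transpose (inverse) of a relation. -/
def relTrans {α : Type*} (R : Set (α × α)) : Set (α × α) := {q | (q.2, q.1) ∈ R}

end

open Polynomial in
theorem exists_polynomial_det_id_add_smul {d : ℕ} (L : Pt d →L[ℝ] Pt d) :
    ∃ p : ℝ[X], p.natDegree ≤ d ∧
      ∀ t : ℝ, p.eval t = (ContinuousLinearMap.id ℝ (Pt d) + t • L).det := by
  let b := (EuclideanSpace.basisFun (Fin d) ℝ).toBasis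
  let A := LinearMap.toMatrix b b (L : Pt d →ₗ[ℝ] Pt d)
  refine ⟨Matrix.det ((X : ℝ[X]) • A.map C + (1 : Matrix (Fin d) (Fin d) ℝ).map C), ?_, ?_⟩
  · simpa using natDegree_det_X_add_C_le A 1
  · intro t
    rw [← coe_evalRingHom, RingHom.map_det, ContinuousLinearMap.det, ← LinearMap.det_toMatrix b]
    congr 1
    have h1 : LinearMap.toMatrix b b
        ((ContinuousLinearMap.id ℝ (Pt d) + t • L :
          Pt d →L[ℝ] Pt d) :
          Pt d →ₗ[ℝ] Pt d) = 1 + t • A := by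
      simp only [ContinuousLinearMap.toLinearMap_add, ContinuousLinearMap.toLinearMap_smul,
        ContinuousLinearMap.coe_id, map_add, LinearMap.toMatrix_id, map_smul, A]
    rw [h1]
    ext i j
    simp only [RingHom.mapMatrix_apply, Matrix.map_apply, Matrix.add_apply, Matrix.smul_apply,
      smul_eq_mul, map_add, eval_mul, coe_evalRingHom, eval_X, eval_C, add_comm]

open Polynomial in
theorem exists_quadrature (d : ℕ) {ε : ℝ} (hε : 0 < ε) :
    ∃ (v w : Fin (d + 1) → ℝ), (∀ i, 0 < v i ∧ v i < ε) ∧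
      ∀ p : ℝ[X], p.natDegree ≤ d → p.eval 1 = ∑ i, w i * p.eval (v i) := by
  let v : Fin (d + 1) → ℝ := fun i => ε * ((i : ℝ) + 1) / (d + 2)
  have hv : Function.Injective v := by
    intro i j h
    have h2 : (0 : ℝ) < d + 2 := by positivity
    simp only [v] at h
    field_simp at h
    have : (i : ℝ) = j := by linarith
    exact Fin.ext (by exact_mod_cast this)
  refine ⟨v, fun i => (Lagrange.basis Finset.univ v i).eval 1, fun i => ⟨by positivity, ?_⟩, ?_⟩
  · have h2 : (0 : ℝ) < d + 2 := by positivity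
    have hi : (i : ℝ) + 1 < d + 2 := by
      have := i.2
      have : (i : ℝ) < d + 1 := by exact_mod_cast this
      linarith
    simp only [v]
    rw [div_lt_iff₀ h2]
    exact mul_lt_mul_of_pos_left hi hε
  · intro p hp
    have h := Lagrange.eq_interpolate (s := Finset.univ) (v := v) (f := p) hv.injOn (by
      rw [Finset.card_univ, Fintype.card_fin]
      refine lt_of_le_of_lt p.degree_le_natDegree ?_
      exact_mod_cast Nat.lt_succ_of_le hp)
    conv_lhs => rw [h]
    rw [Lagrange.interpolate_apply, eval_finsetSum]
    refine Finset.sum_congr rfl fun i _ => ?_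
    rw [eval_mul, eval_C, mul_comm]

theorem not_exists_contDiff_retraction {d : ℕ} {R : ℝ} (hR : 0 < R)
    (r : Pt d → Pt d) (hr : ContDiff ℝ 1 r)
    (hnorm : ∀ x, ‖r x‖ = R) (hid : ∀ x, ‖x‖ = R → r x = x) : False := by
  let A : Pt d → Pt d →L[ℝ] Pt d := fun x => fderiv ℝ r x - ContinuousLinearMap.id ℝ (Pt d)
  have hA : Continuous A := (hr.continuous_fderiv one_ne_zero).sub continuous_const
  let f : ℝ → Pt d → Pt d := fun t x => x + t • (r x - x)
  let J : ℝ → Pt d → Pt d →L[ℝ] Pt d := fun t x => ContinuousLinearMap.id ℝ (Pt d) + t • A x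
  have hf : ∀ t x, HasStrictFDerivAt (f t) (J t x) x := fun t x =>
    (hasStrictFDerivAt_id x).add
      (((hr.contDiffAt.hasStrictFDerivAt one_ne_zero).sub (hasStrictFDerivAt_id x)).const_smul t)
  obtain ⟨C, hC⟩ : ∃ C, ∀ x ∈ closedBall (0 : Pt d) R, ‖A x‖ ≤ C :=
    (isCompact_closedBall _ _).exists_bound_of_continuousOn hA.continuousOn
  have hC0 : 0 ≤ C := (norm_nonneg _).trans (hC 0 (by simp [hR.le]))
  have hlip : ∀ x ∈ closedBall (0 : Pt d) R, ∀ y ∈ closedBall (0 : Pt d) R,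
      ‖(r y - y) - (r x - x)‖ ≤ C * ‖y - x‖ := by
    intro x hx y hy
    refine (convex_closedBall (0 : Pt d) R).norm_image_sub_le_of_norm_hasFDerivWithin_le
      (f := fun x => r x - x) (f' := A) (fun z _ => ?_) hC hx hy
    exact (((hr.contDiffAt.hasStrictFDerivAt one_ne_zero).sub
      (hasStrictFDerivAt_id z)).hasFDerivAt).hasFDerivWithinAt
  set ε : ℝ := min 1 (1 / (C + 1)) with hεdef
  have hε : 0 < ε := lt_min one_pos (by positivity)
  have hεC : ∀ t, 0 ≤ t → t < ε → t * C < 1 := by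
    intro t ht hte
    have h1 : t < 1 / (C + 1) := lt_of_lt_of_le hte (min_le_right _ _)
    rw [lt_div_iff₀ (by positivity)] at h1
    nlinarith
  have hinj : ∀ t, 0 < t → t < ε → InjOn (f t) (closedBall 0 R) := by
    intro t ht hte x hx y hy hxy
    by_contra hne
    have h1 : y - x = -(t • ((r y - y) - (r x - x))) := by
      have : x + t • (r x - x) = y + t • (r y - y) := hxy
      rw [smul_sub t (r y - y), neg_sub, sub_eq_sub_iff_add_eq_add, ← this, add_comm]
    have h2 : ‖y - x‖ ≤ t * (C * ‖y - x‖) := by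
      conv_lhs => rw [h1]
      rw [norm_neg, norm_smul, Real.norm_of_nonneg ht.le]
      exact mul_le_mul_of_nonneg_left (hlip x hx y hy) ht.le
    have h3 : 0 < ‖y - x‖ := norm_pos_iff.2 (sub_ne_zero.2 (Ne.symm hne))
    nlinarith [hεC t ht.le hte]
  have hJinj : ∀ t, 0 ≤ t → t < ε → ∀ x ∈ closedBall (0 : Pt d) R, (J t x).det ≠ 0 := by
    intro t ht hte x hx h0
    obtain ⟨v, hv, hv0⟩ := Submodule.exists_mem_ne_zero_of_ne_bot
      (LinearMap.bot_lt_ker_of_det_eq_zero h0).ne'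
    have h1 : v + t • A x v = 0 := hv
    have h2 : ‖v‖ ≤ t * (C * ‖v‖) := by
      conv_lhs => rw [eq_neg_of_add_eq_zero_left h1]
      rw [norm_neg, norm_smul, Real.norm_of_nonneg ht]
      exact mul_le_mul_of_nonneg_left
        (((A x).le_opNorm v).trans (mul_le_mul_of_nonneg_right (hC x hx) (norm_nonneg v))) ht
    have h3 : 0 < ‖v‖ := norm_pos_iff.2 hv0
    nlinarith [hεC t ht hte]
  have hJpos : ∀ t, 0 < t → t < ε → ∀ x ∈ closedBall (0 : Pt d) R, 0 < (J t x).det := by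
    intro t ht hte x hx
    by_contra hneg
    have hc : ContinuousOn (fun s : ℝ => (J s x).det) (Icc 0 t) := by
      apply Continuous.continuousOn
      exact ContinuousLinearMap.continuous_det.comp (by fun_prop)
    obtain ⟨s, hs, hs0⟩ := intermediate_value_Icc' ht.le hc
      (show (0 : ℝ) ∈ _ from ⟨not_lt.1 hneg, by simp [J, ContinuousLinearMap.det]⟩)
    exact hJinj s hs.1 (hs.2.trans_lt hte) x hx hs0
  have himage : ∀ t, 0 < t → t < ε → f t '' ball 0 R = ball 0 R := by
    intro t ht hte
    have ht1 : t < 1 := lt_of_lt_of_le hte (min_le_left _ _)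
    have hfc : Continuous (f t) := continuous_iff_continuousAt.2 fun x => (hf t x).continuousAt
    have hmaps : ∀ x ∈ ball (0 : Pt d) R, f t x ∈ ball (0 : Pt d) R := by
      intro x hx
      rw [mem_ball_zero_iff] at hx ⊢
      have : f t x = (1 - t) • x + t • r x := by simp only [f]; module
      rw [this]
      refine (norm_add_le _ _).trans_lt ?_
      rw [norm_smul, norm_smul, hnorm, Real.norm_of_nonneg ht.le, Real.norm_of_nonneg (by linarith)]
      nlinarith
    have hopen : IsOpen (f t '' ball 0 R) := by
      rw [isOpen_iff_mem_nhds]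
      rintro _ ⟨x, hx, rfl⟩
      have hsurj : (J t x : Pt d →ₗ[ℝ] Pt d).range = ⊤ := by
        have := (hJpos t ht hte x (ball_subset_closedBall hx)).ne'
        exact LinearMap.range_eq_top.2 ((LinearMap.isUnit_iff_isUnit_det _).2 this.isUnit |> (Module.End.isUnit_iff _).1).2
      rw [← (hf t x).map_nhds_eq_of_surj hsurj]
      exact Filter.image_mem_map (isOpen_ball.mem_nhds hx)
    have hclosed : f t '' ball 0 R = f t '' closedBall 0 R ∩ ball 0 R := by
      apply Subset.antisymm
      · rintro _ ⟨x, hx, rfl⟩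
        exact ⟨mem_image_of_mem _ (ball_subset_closedBall hx), hmaps x hx⟩
      · rintro _ ⟨⟨x, hx, rfl⟩, hfx⟩
        refine mem_image_of_mem _ ?_
        by_contra hxb
        have hxR : ‖x‖ = R := le_antisymm (mem_closedBall_zero_iff.1 hx)
          (not_lt.1 fun h => hxb (mem_ball_zero_iff.2 h))
        have : f t x = x := by simp [f, hid x hxR]
        rw [this] at hfx
        exact hxb hfx
    have hcpt : IsClosed (f t '' closedBall 0 R) :=
      ((isCompact_closedBall (0 : Pt d) R).image hfc).isClosed
    refine Subset.antisymm (by rintro _ ⟨x, hx, rfl⟩; exact hmaps x hx) ?_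
    refine ((convex_ball (0 : Pt d) R).isPreconnected).subset_left_of_subset_union hopen
      hcpt.isOpen_compl ?_ ?_ ?_
    · rw [Set.disjoint_compl_right_iff_subset]
      exact image_mono ball_subset_closedBall
    · intro y hy
      by_cases h : y ∈ f t '' closedBall 0 R
      · left; rw [hclosed]; exact ⟨h, hy⟩
      · exact Or.inr h
    · exact ⟨f t 0, hmaps 0 (by simp [hR]), mem_image_of_mem _ (by simp [hR])⟩
  have hdetcont : ∀ t, Continuous fun x => (J t x).det := fun t =>
    ContinuousLinearMap.continuous_det.comp (by fun_prop)
  have hint : ∀ t, MeasureTheory.IntegrableOn (fun x => (J t x).det) (ball (0 : Pt d) R) := fun t =>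
    ((hdetcont t).continuousOn.integrableOn_compact (isCompact_closedBall (0 : Pt d) R)).mono_set
      ball_subset_closedBall
  have hvol : ∀ t, 0 < t → t < ε → ∫ x in ball (0 : Pt d) R, (J t x).det =
      MeasureTheory.volume.real (ball (0 : Pt d) R) := by
    intro t ht hte
    have h := MeasureTheory.integral_image_eq_integral_abs_det_fderiv_smul MeasureTheory.volume
      (measurableSet_ball (x := (0 : Pt d)) (ε := R))
      (fun x _ => (hf t x).hasFDerivAt.hasFDerivWithinAt)
      ((hinj t ht hte).mono ball_subset_closedBall) (fun _ => (1 : ℝ))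
    rw [himage t ht hte] at h
    simp only [MeasureTheory.integral_const, smul_eq_mul, mul_one, MeasureTheory.measureReal_restrict_apply_univ] at h
    rw [h]
    refine MeasureTheory.setIntegral_congr_fun measurableSet_ball fun x hx => ?_
    exact (abs_of_pos (hJpos t ht hte x (ball_subset_closedBall hx))).symm
  obtain ⟨v, w, hv, hw⟩ := exists_quadrature d hε
  have hdet1 : ∀ x, (J 1 x).det = ∑ i, w i * (J (v i) x).det := by
    intro x
    obtain ⟨p, hp, hpe⟩ := exists_polynomial_det_id_add_smul (A x)
    have := hw p hp
    simpa only [hpe] using this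
  have hone : ∑ i, w i = 1 := by
    have := hw 1 (by simp)
    simpa using this.symm
  have hfinal : ∫ x in ball (0 : Pt d) R, (J 1 x).det = MeasureTheory.volume.real (ball (0 : Pt d) R) := by
    simp_rw [hdet1]
    rw [MeasureTheory.integral_finsetSum _ fun i _ => ((hint (v i)).const_mul (w i))]
    simp_rw [MeasureTheory.integral_const_mul]
    rw [Finset.sum_congr rfl fun i _ => by rw [hvol (v i) (hv i).1 (hv i).2], ← Finset.sum_mul, hone, one_mul]
  have hzero : ∀ x, (J 1 x).det = 0 := by
    intro x
    by_contra hne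
    have hsurj : Function.Surjective (J 1 x) :=
      ((LinearMap.isUnit_iff_isUnit_det _).2 (IsUnit.mk0 _ hne) |> (Module.End.isUnit_iff _).1).2
    obtain ⟨u, hu⟩ := hsurj (r x)
    have hJ : J 1 x = fderiv ℝ r x := by simp [J, A]
    have hd : HasFDerivAt (fun y => ‖r y‖ ^ 2) (2 • (innerSL ℝ (r x)).comp (fderiv ℝ r x)) x :=
      ((hr.differentiable one_ne_zero) x).hasFDerivAt.norm_sq
    simp_rw [hnorm] at hd
    have h0 := hd.unique (hasFDerivAt_const (R ^ 2) x)
    have h1 := congrArg (fun L : Pt d →L[ℝ] ℝ => L u) h0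
    rw [hJ] at hu
    simp [hu, hnorm, hR.ne'] at h1
  simp only [hzero, MeasureTheory.integral_zero] at hfinal
  have : 0 < MeasureTheory.volume.real (ball (0 : Pt d) R) :=
    ENNReal.toReal_pos (measure_ball_pos _ _ hR).ne' MeasureTheory.measure_ball_lt_top.ne
  linarith

theorem exists_zero_of_eq_id_of_le_norm {d : ℕ} (M : Pt d → Pt d) (hM : Continuous M)
    (R : ℝ) (h : ∀ x, R ≤ ‖x‖ → M x = x) : ∃ x, M x = 0 := by
  by_contra! hne
  set R' : ℝ := max R 0 + 1 with hR'
  have hRR : R < R' := by have := le_max_left R 0; linarith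
  have hR0 : 0 < R' := by have := le_max_right R 0; linarith
  have hS : IsClosed {x : Pt d | R' ≤ ‖x‖} := isClosed_le continuous_const continuous_norm
  have hU : IsOpen {x : Pt d | R < ‖x‖} := isOpen_lt continuous_const continuous_norm
  obtain ⟨g, hg, hgd, hge, -⟩ := hM.exists_contDiff_approx_and_eqOn 1 hM.norm
    (fun x => norm_pos_iff.2 (hne x)) hS
    (hU.mem_nhdsSet.2 fun x (hx : R' ≤ ‖x‖) => hRR.trans_le hx)
    (contDiffOn_id.congr fun x (hx : R < ‖x‖) => h x hx.le)
  have hg0 : ∀ x, g x ≠ 0 := by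
    intro x hx
    have := hgd x
    rw [hx, dist_zero_left] at this
    exact lt_irrefl _ this
  refine not_exists_contDiff_retraction hR0 (fun x => (R' / ‖g x‖) • g x) ?_ ?_ ?_
  · exact (contDiff_const.div (hg.norm ℝ hg0) fun x => norm_ne_zero_iff.2 (hg0 x)).smul hg
  · intro x
    rw [norm_smul, norm_div, norm_norm, div_mul_cancel₀ _ (norm_ne_zero_iff.2 (hg0 x)), Real.norm_of_nonneg hR0.le]
  · intro x hx
    have : g x = x := by rw [hge (show R' ≤ ‖x‖ from hx.ge)]; exact h x (by rw [hx]; exact hRR.le)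
    rw [this, hx, div_self hR0.ne', one_smul]

theorem exists_interior_nonempty_of_subset_biUnion {X ι : Type*} [TopologicalSpace X]
    (s : Finset ι) (F : ι → Set X) (hF : ∀ i ∈ s, IsClosed (F i)) {V : Set X} (hV : IsOpen V)
    (hne : V.Nonempty) (hsub : V ⊆ ⋃ i ∈ s, F i) :
    ∃ i ∈ s, (V ∩ interior (F i)).Nonempty := by
  classical
  induction s using Finset.induction_on generalizing V with
  | empty =>
    obtain ⟨x, hx⟩ := hne
    simpa using hsub hx
  | insert a s ha ih =>
    by_cases h : (V ∩ (F a)ᶜ).Nonempty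
    · obtain ⟨i, hi, x, hx, hxi⟩ := ih (fun i hi => hF i (Finset.mem_insert_of_mem hi))
        (hV.inter (hF a (Finset.mem_insert_self _ _)).isOpen_compl) h (fun x hx => by
          have := hsub hx.1
          rw [Finset.set_biUnion_insert] at this
          exact this.resolve_left hx.2)
      exact ⟨i, Finset.mem_insert_of_mem hi, x, hx.1, hxi⟩
    · have hVa : V ⊆ F a := fun x hx => by
        by_contra hxa
        exact h ⟨x, hx, hxa⟩
      obtain ⟨x, hx⟩ := hne
      exact ⟨a, Finset.mem_insert_self _ _, x, hx, interior_maximal hVa hV hx⟩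

theorem exists_isOpen_injOn_of_det_fderiv_ne_zero {d : ℕ} {F : Pt d → Pt d}
    (hF : ContDiff ℝ 1 F) {x : Pt d} (hdet : (fderiv ℝ F x).det ≠ 0) :
    ∃ U : Set (Pt d), IsOpen U ∧ x ∈ U ∧ InjOn F U := by
  have hstrict : HasStrictFDerivAt F
      (((fderiv ℝ F x).toContinuousLinearEquivOfDetNeZero hdet : Pt d ≃L[ℝ] Pt d) :
        Pt d →L[ℝ] Pt d) x := by
    rw [ContinuousLinearMap.coe_toContinuousLinearEquivOfDetNeZero]
    exact hF.contDiffAt.hasStrictFDerivAt one_ne_zero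
  have hinj := (hstrict.toOpenPartialHomeomorph F).injOn
  rw [hstrict.toOpenPartialHomeomorph_coe] at hinj
  exact ⟨_, (hstrict.toOpenPartialHomeomorph F).open_source,
    hstrict.mem_toOpenPartialHomeomorph_source, hinj⟩

theorem eq_empty_of_subset_image_of_injOn {X Y : Type*} [TopologicalSpace X] [TopologicalSpace Y]
    {F : X → Y} (hF : Continuous F) {C U : Set X} (hint : interior C = ∅) (hU : IsOpen U)
    (hinj : InjOn F U) {W : Set Y} (hW : IsOpen W) (hWC : W ⊆ F '' (U ∩ C)) : W = ∅ := by
  have hsub : U ∩ F ⁻¹' W ⊆ C := by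
    rintro z ⟨hz, hzW⟩
    obtain ⟨c, ⟨hc, hcC⟩, hcz⟩ := hWC hzW
    exact hinj hc hz hcz ▸ hcC
  have hempty : U ∩ F ⁻¹' W = ∅ := by
    rw [← subset_empty_iff, ← hint]
    exact interior_maximal hsub (hU.inter (hW.preimage hF))
  rw [eq_empty_iff_forall_notMem]
  intro w hw
  obtain ⟨c, ⟨hc, _⟩, rfl⟩ := hWC hw
  exact (eq_empty_iff_forall_notMem.1 hempty) c ⟨hc, hw⟩

theorem volume_image_setOf_det_fderiv_eq_zero {d : ℕ} {F : Pt d → Pt d} (hF : ContDiff ℝ 1 F)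
    (C : Set (Pt d)) : MeasureTheory.volume (F '' (C ∩ {x | (fderiv ℝ F x).det = 0})) = 0 :=
  MeasureTheory.addHaar_image_eq_zero_of_det_fderivWithin_eq_zero MeasureTheory.volume
    (f' := fderiv ℝ F)
    (fun x _ => (hF.differentiable one_ne_zero x).hasFDerivAt.hasFDerivWithinAt)
    (fun _ hx => hx.2)

theorem interior_image_eq_empty_of_contDiff {d : ℕ} {F : Pt d → Pt d} (hF : ContDiff ℝ 1 F)
    {C : Set (Pt d)} (hC : IsCompact C) (hint : interior C = ∅) : interior (F '' C) = ∅ := by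
  by_contra hne
  rw [← ne_eq, ← nonempty_iff_ne_empty] at hne
  have hZ : IsClosed {x | (fderiv ℝ F x).det = 0} := isClosed_eq
    (ContinuousLinearMap.continuous_det.comp (hF.continuous_fderiv one_ne_zero)) continuous_const
  have hZ0 := volume_image_setOf_det_fderiv_eq_zero hF C
  have hreg : ∀ x, x ∉ {x | (fderiv ℝ F x).det = 0} → ∃ U : Set (Pt d), IsOpen U ∧ x ∈ U ∧
      InjOn F U := fun x hx => exists_isOpen_injOn_of_det_fderiv_ne_zero hF hx
  generalize {x | (fderiv ℝ F x).det = 0} = Z at hZ hZ0 hreg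
  obtain ⟨y, hyV, hyZ⟩ : ∃ y ∈ interior (F '' C), y ∉ F '' (C ∩ Z) := by
    by_contra! hsub
    exact (isOpen_interior.measure_pos MeasureTheory.volume hne).ne'
      (MeasureTheory.measure_mono_null hsub hZ0)
  have hZc : IsClosed (F '' (C ∩ Z)) := ((hC.inter_right hZ).image hF.continuous).isClosed
  obtain ⟨δ, hδ, hball⟩ := Metric.nhds_basis_closedBall.mem_iff.1
    ((isOpen_interior.inter hZc.isOpen_compl).mem_nhds ⟨hyV, hyZ⟩)
  have hD : IsCompact (C ∩ F ⁻¹' closedBall y δ) :=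
    hC.inter_right (isClosed_closedBall.preimage hF.continuous)
  have hloc : ∀ x ∈ C ∩ F ⁻¹' closedBall y δ, ∃ r > 0, ∃ U : Set (Pt d), IsOpen U ∧
      closedBall x r ⊆ U ∧ InjOn F U := by
    intro x hx
    obtain ⟨U, hU, hxU, hinj⟩ := hreg x fun hxZ => (hball hx.2).2 ⟨x, ⟨hx.1, hxZ⟩, rfl⟩
    obtain ⟨r, hr, hrU⟩ := Metric.nhds_basis_closedBall.mem_iff.1 (hU.mem_nhds hxU)
    exact ⟨r, hr, U, hU, hrU, hinj⟩
  choose! r hr0 U hUo hrU hUinj using hloc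
  obtain ⟨t, htD, ht⟩ := hD.elim_nhds_subcover (fun x => closedBall x (r x))
    (fun x hx => closedBall_mem_nhds x (hr0 x hx))
  have hcov : ball y δ ⊆ ⋃ x ∈ t, F '' (closedBall x (r x) ∩ C) := by
    intro z hz
    have hzC : z ∈ F '' C := interior_subset (hball (ball_subset_closedBall hz)).1
    rw [mem_image] at hzC
    obtain ⟨c, hc, hcz⟩ := hzC
    rw [← hcz] at hz ⊢
    have hcy : F c ∈ closedBall y δ := ball_subset_closedBall hz
    have hcU : c ∈ ⋃ x ∈ t, closedBall x (r x) := ht ⟨hc, hcy⟩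
    simp only [mem_iUnion, exists_prop] at hcU ⊢
    obtain ⟨x, hx, hcx⟩ := hcU
    exact ⟨x, hx, mem_image_of_mem F ⟨hcx, hc⟩⟩
  have hcl : ∀ x ∈ t, IsClosed (F '' (closedBall x (r x) ∩ C)) := fun x _ =>
    (((isCompact_closedBall x (r x)).inter_right hC.isClosed).image hF.continuous).isClosed
  obtain ⟨x, hxt, w, hw⟩ := exists_interior_nonempty_of_subset_biUnion t _ hcl
    (isOpen_ball (x := y) (ε := δ)) ⟨y, mem_ball_self hδ⟩ hcov
  have hsub : interior (F '' (closedBall x (r x) ∩ C)) ⊆ F '' (U x ∩ C) :=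
    interior_subset.trans (image_mono (inter_subset_inter_left _ (hrU x (htD x hxt))))
  have := eq_empty_of_subset_image_of_injOn hF.continuous hint (hUo x (htD x hxt))
    (hUinj x (htD x hxt)) isOpen_interior hsub
  exact (eq_empty_iff_forall_notMem.1 this) w hw.2

theorem exists_continuous_ne_zero_of_compact {d : ℕ} {C : Set (Pt d)} (hC : IsCompact C)
    (hint : interior C = ∅) {Φ : Pt d → Pt d} (hΦ : Continuous Φ) {ε : ℝ} (hε : 0 < ε) :
    ∃ F : Pt d → Pt d, Continuous F ∧ (∀ x, ‖F x - Φ x‖ < ε) ∧ ∀ x ∈ C, F x ≠ 0 := by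
  obtain ⟨g, hg, hgd, -⟩ := hΦ.exists_contDiff_approx 1 (continuous_const (y := ε / 2))
    (fun _ => half_pos hε)
  have himg := interior_image_eq_empty_of_contDiff hg hC hint
  obtain ⟨v, hvb, hv⟩ : ∃ v ∈ ball (0 : Pt d) (ε / 2), v ∉ g '' C := by
    by_contra! hsub
    have : (0 : Pt d) ∈ interior (g '' C) :=
      interior_maximal hsub isOpen_ball (mem_ball_self (half_pos hε))
    simp [himg] at this
  refine ⟨fun x => g x - v, hg.continuous.sub continuous_const, fun x => ?_, fun x hx h0 => ?_⟩
  · have h1 := hgd x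
    rw [dist_eq_norm] at h1
    rw [mem_ball_zero_iff] at hvb
    calc ‖g x - v - Φ x‖ = ‖(g x - Φ x) - v‖ := by congr 1; abel
      _ ≤ ‖g x - Φ x‖ + ‖v‖ := norm_sub_le _ _
      _ < ε := by linarith
  · exact hv ⟨x, hx, sub_eq_zero.1 h0⟩

theorem exists_continuous_extension {X : Type*} [TopologicalSpace X] [NormalSpace X] {d : ℕ}
    {C : Set X} (hC : IsClosed C) {f : X → Pt d} (hf : ContinuousOn f C) :
    ∃ g : X → Pt d, Continuous g ∧ EqOn g f C := by
  obtain ⟨g, hg⟩ := ContinuousMap.exists_restrict_eq (Y := Fin d → ℝ) hC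
    ⟨fun x : C => WithLp.ofLp (f x), (PiLp.continuous_ofLp 2 _).comp
      (continuousOn_iff_continuous_domRestrict.1 hf)⟩
  refine ⟨fun x => WithLp.toLp 2 (g x), (PiLp.continuous_toLp 2 _).comp g.continuous,
    fun x hx => ?_⟩
  have := congrArg (fun k : C(C, Fin d → ℝ) => k ⟨x, hx⟩) hg
  simp only [ContinuousMap.restrict_apply, ContinuousMap.coe_mk] at this
  simp [this]

/-- A continuous map factors, on a compact set, through any continuous injection. -/
theorem exists_continuous_factor {X Y : Type*} [TopologicalSpace X] [TopologicalSpace Y] [T4Space Y]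
    {d : ℕ} {C : Set X} (hC : IsCompact C) {j : X → Y} (hj : ContinuousOn j C)
    (hinj : InjOn j C) {Θ : X → Pt d} (hΘ : Continuous Θ) :
    ∃ k : Y → Pt d, Continuous k ∧ ∀ x ∈ C, k (j x) = Θ x := by
  have hemb : Topology.IsClosedEmbedding (C.domRestrict j) := by
    have := isCompact_iff_compactSpace.1 hC
    exact (continuousOn_iff_continuous_domRestrict.1 hj).isClosedEmbedding
      (injOn_iff_injective.1 hinj)
  let e := hemb.isEmbedding.toHomeomorph
  have hcl : IsClosed (range (C.domRestrict j)) := hemb.isClosed_range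
  classical
  obtain ⟨g, hg, hgeq⟩ := exists_continuous_extension hcl
    (f := fun y => if h : y ∈ range (C.domRestrict j) then Θ (e.symm ⟨y, h⟩) else 0) (by
      rw [continuousOn_iff_continuous_domRestrict]
      have : (range (C.domRestrict j)).domRestrict
          (fun y => if h : y ∈ range (C.domRestrict j) then Θ (e.symm ⟨y, h⟩) else 0) =
          fun y => Θ (e.symm y) := by
        ext1 y
        simp only [Set.domRestrict_apply, y.2, dif_pos]
      rw [this]
      exact hΘ.comp (continuous_subtype_val.comp e.symm.continuous))
  refine ⟨g, hg, fun x hx => ?_⟩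
  have hmem : j x ∈ range (C.domRestrict j) := ⟨⟨x, hx⟩, rfl⟩
  rw [hgeq hmem]
  simp only [hmem, dif_pos]
  have : e.symm ⟨j x, hmem⟩ = ⟨x, hx⟩ := by
    rw [Homeomorph.symm_apply_eq]; rfl
  rw [this]

/-- A map to `ℝ^d` can be pushed off the origin on a compact set which embeds in `ℝ^d` with empty
interior, without changing it where it is already far from the origin. -/
theorem exists_continuous_avoiding_zero {X : Type*} [TopologicalSpace X] [T4Space X] {d : ℕ}
    {C : Set X} (hC : IsCompact C) {j : X → Pt d} (hj : ContinuousOn j C) (hinj : InjOn j C)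
    (hint : interior (j '' C) = ∅) {Θ : X → Pt d} (hΘ : Continuous Θ) {δ : ℝ} (hδ : 0 < δ) :
    ∃ Ψ : X → Pt d, Continuous Ψ ∧ (∀ x, δ ≤ ‖Θ x‖ → Ψ x = Θ x) ∧
      (∀ x ∈ C, Ψ x ≠ 0) ∧ ∀ x ∈ C, ‖Ψ x - Θ x‖ ≤ δ := by
  obtain ⟨k, hk, hkj⟩ := exists_continuous_factor hC hj hinj hΘ
  obtain ⟨F, hF, hFk, hF0⟩ := exists_continuous_ne_zero_of_compact (hC.image_of_continuousOn hj)
    hint hk (half_pos hδ)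
  obtain ⟨G, hG, hGF⟩ := exists_continuous_extension hC.isClosed
    (hF.comp_continuousOn hj)
  let μ : X → ℝ := fun x => max 0 (min 1 (2 * ‖Θ x‖ / δ - 1))
  have hμ : Continuous μ := by fun_prop
  have hμ0 : ∀ x, 0 ≤ μ x := fun x => le_max_left _ _
  have hμ1 : ∀ x, μ x ≤ 1 := fun x => max_le zero_le_one (min_le_left _ _)
  have hclose : ∀ x ∈ C, ‖G x - Θ x‖ < δ / 2 := by
    intro x hx
    rw [hGF hx, ← hkj x hx]
    exact hFk (j x)
  have hclose' : ∀ x ∈ C, ‖(1 - μ x) • (G x - Θ x)‖ < δ / 2 := by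
    intro x hx
    rw [norm_smul, Real.norm_of_nonneg (by linarith [hμ1 x])]
    have h1 := hclose x hx
    have h2 := norm_nonneg (G x - Θ x)
    nlinarith [hμ0 x, hμ1 x]
  refine ⟨fun x => Θ x + (1 - μ x) • (G x - Θ x), by fun_prop, ?_, ?_, ?_⟩
  · intro x hx
    have : μ x = 1 := by
      have h1 : 1 ≤ ‖Θ x‖ / δ := (one_le_div hδ).2 hx
      have h2 : (1 : ℝ) ≤ 2 * ‖Θ x‖ / δ - 1 := by rw [mul_div_assoc]; linarith
      simp only [μ]
      rw [min_eq_left h2]; norm_num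
    simp [this]
  · intro x hx h0
    replace h0 : Θ x + (1 - μ x) • (G x - Θ x) = 0 := h0
    rcases le_or_gt ‖Θ x‖ (δ / 2) with h | h
    · have : μ x = 0 := by
        have h1 : ‖Θ x‖ / δ ≤ 1 / 2 := by rw [div_le_iff₀ hδ]; linarith
        have h2 : 2 * ‖Θ x‖ / δ - 1 ≤ 0 := by rw [mul_div_assoc]; linarith
        exact max_eq_left ((min_le_right _ _).trans h2)
      rw [this] at h0
      apply hF0 (j x) (mem_image_of_mem j hx)
      have h3 := hGF hx
      simp only [Function.comp_apply] at h3
      rw [← h3]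
      simpa using h0
    · have := hclose' x hx
      rw [eq_neg_of_add_eq_zero_left h0, norm_neg] at h
      linarith
  · intro x hx
    rw [add_sub_cancel_left]
    exact ((hclose' x hx).trans (half_lt_self hδ)).le

/-- Radial retraction onto the closed unit ball. -/
theorem exists_continuous_retraction_closedBall (d : ℕ) : ∃ ρ : Pt d → Pt d, Continuous ρ ∧
    (∀ x, ρ x ∈ closedBall (0 : Pt d) 1) ∧ ∀ x ∈ closedBall (0 : Pt d) 1, ρ x = x := by
  have hpos : ∀ x : Pt d, 0 < max 1 ‖x‖ := fun x => zero_lt_one.trans_le (le_max_left _ _)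
  refine ⟨fun x => (max 1 ‖x‖)⁻¹ • x, ?_, fun x => ?_, fun x hx => ?_⟩
  · exact ((continuous_const.max continuous_norm).inv₀ fun x => (hpos x).ne').smul continuous_id
  · rw [mem_closedBall_zero_iff, norm_smul, norm_inv, Real.norm_of_nonneg (hpos x).le,
      inv_mul_le_iff₀ (hpos x), mul_one]
    exact le_max_right _ _
  · rw [mem_closedBall_zero_iff] at hx
    simp [max_eq_left hx]

/-- A perturbation by at most `1` of the identity of the closed unit ball has a zero. -/
theorem exists_zero_of_norm_sub_le_one {d : ℕ} {ρ K : Pt d → Pt d} (hρ : Continuous ρ)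
    (hρ1 : ∀ x ∈ closedBall (0 : Pt d) 1, ρ x = x) (hK : Continuous K)
    (hKρ : ∀ x, ‖K x - ρ x‖ ≤ 1) : ∃ x, K x = 0 := by
  let μ : Pt d → ℝ := fun x => max 0 (min 1 (2 - ‖x‖))
  have hμ : Continuous μ := by fun_prop
  have hμ0 : ∀ x, 0 ≤ μ x := fun x => le_max_left _ _
  have hμ1 : ∀ x, μ x ≤ 1 := fun x => max_le zero_le_one (min_le_left _ _)
  obtain ⟨x, hx⟩ := exists_zero_of_eq_id_of_le_norm (fun x => x + μ x • (K x - ρ x))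
    (by fun_prop) 2 (fun x hx => by
      have : μ x = 0 := max_eq_left ((min_le_right _ _).trans (by linarith))
      simp [this])
  refine ⟨x, ?_⟩
  have hx' : x = -(μ x • (K x - ρ x)) := eq_neg_of_add_eq_zero_left hx
  have hxn : ‖x‖ ≤ 1 := by
    rw [hx', norm_neg, norm_smul, Real.norm_of_nonneg (hμ0 x)]
    exact mul_le_one₀ (hμ1 x) (norm_nonneg _) (hKρ x)
  have hμx : μ x = 1 := by
    have : (1 : ℝ) ≤ 2 - ‖x‖ := by linarith
    simp only [μ]
    rw [min_eq_left this]; norm_num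
  have hρx := hρ1 x (mem_closedBall_zero_iff.2 hxn)
  simp only [hμx, hρx, one_smul] at hx
  simpa using hx

theorem mem_interior_image_closedBall {d : ℕ} {h : Pt d → Pt d}
    (hc : ContinuousOn h (closedBall 0 1)) (hi : InjOn h (closedBall 0 1)) :
    h 0 ∈ interior (h '' closedBall 0 1) := by
  by_contra hne
  have hB : IsCompact (closedBall (0 : Pt d) 1) := isCompact_closedBall 0 1
  have hA : IsCompact (h '' closedBall 0 1) := hB.image_of_continuousOn hc
  have h0B : (0 : Pt d) ∈ closedBall (0 : Pt d) 1 := mem_closedBall_self zero_le_one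
  obtain ⟨G, hG, hGh⟩ := exists_continuous_factor hB hc hi continuous_id
  simp only [id_eq] at hGh
  obtain ⟨η, hη, hGη⟩ := Metric.continuous_iff.1 hG (h 0) (1 / 10) (by norm_num)
  rw [hGh 0 h0B] at hGη
  simp only [dist_zero_right] at hGη
  obtain ⟨ε, hε, hεη⟩ : ∃ ε > 0, 2 * ε < η := ⟨η / 3, by positivity, by linarith⟩
  obtain ⟨c, hcb, hcA⟩ : ∃ c ∈ ball (h 0) ε, c ∉ h '' closedBall 0 1 := by
    by_contra! hsub
    exact hne (interior_maximal hsub isOpen_ball (mem_ball_self hε))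
  have hc0 : ∀ y, ‖y - c‖ ≤ ε → ‖G y‖ < 1 / 10 := by
    intro y hy
    refine hGη y ?_
    have h1 := dist_triangle y c (h 0)
    rw [dist_eq_norm y c] at h1
    rw [mem_ball] at hcb
    linarith
  have hfar : IsCompact (h '' closedBall 0 1 ∩ {y | ε ≤ ‖y - c‖}) :=
    hA.inter_right (isClosed_le continuous_const (by fun_prop))
  obtain ⟨δ₀, hδ₀, hδG⟩ := hfar.exists_forall_le' (a := (0 : ℝ)) (hG.norm.continuousOn) (by
    rintro _ ⟨⟨x, hx, rfl⟩, hxε⟩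
    rw [hGh x hx, norm_pos_iff]
    rintro rfl
    rw [mem_ofPred_eq, ← dist_eq_norm, dist_comm] at hxε
    exact absurd (mem_ball.1 hcb) (not_lt.2 hxε))
  have hδ : 0 < min δ₀ (1 / 10) := lt_min hδ₀ (by norm_num)
  obtain ⟨Ψ, hΨ, hΨG, hΨ0, hΨδ⟩ := exists_continuous_avoiding_zero (isCompact_sphere c ε)
    (continuousOn_id) (injOn_id _) (by rw [image_id]; exact interior_sphere c hε.ne') hG hδ
  obtain ⟨ρ, hρ, hρB, hρ1⟩ := exists_continuous_retraction_closedBall d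
  have hH : Continuous (fun x => h (ρ x)) := hc.comp_continuous hρ hρB
  have hHc : ∀ x, 0 < ‖h (ρ x) - c‖ := by
    intro x
    rw [norm_pos_iff, sub_ne_zero]
    exact fun he => hcA ⟨_, hρB x, he⟩
  have hK : ∀ x, Ψ (c + max (ε / ‖h (ρ x) - c‖) 1 • (h (ρ x) - c)) ≠ 0 ∧
      ‖Ψ (c + max (ε / ‖h (ρ x) - c‖) 1 • (h (ρ x) - c)) - ρ x‖ ≤ 1 := by
    intro x
    rcases le_or_gt ε ‖h (ρ x) - c‖ with hle | hlt
    · rw [max_eq_right ((div_le_one (hHc x)).2 hle), one_smul, add_sub_cancel]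
      have h1 := hδG (h (ρ x)) ⟨⟨_, hρB x, rfl⟩, hle⟩
      rw [hΨG _ ((min_le_left _ _).trans h1), hGh _ (hρB x)]
      rw [hGh _ (hρB x)] at h1
      exact ⟨norm_pos_iff.1 (hδ₀.trans_le h1), by simp⟩
    · rw [max_eq_left ((one_le_div (hHc x)).2 hlt.le)]
      have h1 : ‖(c + (ε / ‖h (ρ x) - c‖) • (h (ρ x) - c)) - c‖ = ε := by
        rw [add_sub_cancel_left, norm_smul, Real.norm_of_nonneg (div_pos hε (hHc x)).le,
          div_mul_cancel₀ _ (hHc x).ne']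
      generalize c + (ε / ‖h (ρ x) - c‖) • (h (ρ x) - c) = z at h1
      have hz : z ∈ sphere c ε := mem_sphere_iff_norm.2 h1
      have h2 := hΨδ z hz
      have h3 := hc0 z h1.le
      have h4 := hc0 (h (ρ x)) hlt.le
      rw [hGh _ (hρB x)] at h4
      have h5 : ‖Ψ z - ρ x‖ ≤ ‖Ψ z - G z‖ + ‖G z‖ + ‖ρ x‖ := by
        calc ‖Ψ z - ρ x‖ = ‖(Ψ z - G z) + G z - ρ x‖ := by congr 1; abel
          _ ≤ _ := (norm_sub_le _ _).trans (add_le_add_left (norm_add_le _ _) _)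
      have h6 := min_le_right δ₀ (1 / 10)
      exact ⟨hΨ0 z hz, by linarith⟩
  obtain ⟨x, hx⟩ := exists_zero_of_norm_sub_le_one hρ hρ1
    (K := fun x => Ψ (c + max (ε / ‖h (ρ x) - c‖) 1 • (h (ρ x) - c)))
    (hΨ.comp (continuous_const.add (((continuous_const.div (hH.sub continuous_const).norm
      fun x => (hHc x).ne').max continuous_const).smul (hH.sub continuous_const))))
    (fun x => (hK x).2)
  exact (hK x).1 hx

/-- Invariance of domain. -/
theorem isOpen_image_of_continuousOn_of_injOn {d : ℕ} {h : Pt d → Pt d} {U : Set (Pt d)}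
    (hU : IsOpen U) (hc : ContinuousOn h U) (hi : InjOn h U) : IsOpen (h '' U) := by
  rw [isOpen_iff_mem_nhds]
  rintro _ ⟨x, hx, rfl⟩
  obtain ⟨r, hr, hrU⟩ := Metric.nhds_basis_closedBall.mem_iff.1 (hU.mem_nhds hx)
  have hmap : MapsTo (fun y : Pt d => x + r • y) (closedBall 0 1) (closedBall x r) := by
    intro y hy
    rw [mem_closedBall_zero_iff] at hy
    rw [mem_closedBall_iff_norm, add_sub_cancel_left, norm_smul, Real.norm_of_nonneg hr.le]
    exact mul_le_of_le_one_right hr.le hy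
  have h1 := mem_interior_image_closedBall (h := fun y => h (x + r • y))
    ((hc.mono hrU).comp (by fun_prop) hmap) (fun y hy z hz hyz => by
      have := hi (hrU (hmap hy)) (hrU (hmap hz)) hyz
      exact smul_right_injective _ hr.ne' (add_left_cancel this))
  simp only [smul_zero, add_zero] at h1
  refine Filter.mem_of_superset (mem_interior_iff_mem_nhds.1 h1) ?_
  rintro _ ⟨y, hy, rfl⟩
  exact ⟨_, hrU (hmap hy), rfl⟩

/-- The spherical shell over a nowhere dense subset of the sphere has empty interior. -/
theorem interior_shell_eq_empty {d : ℕ} {K : Set (Pt d)} (hK : K ⊆ sphere 0 1)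
    (hint : ∀ U : Set (Pt d), IsOpen U → U ∩ sphere 0 1 ⊆ K → U ∩ sphere 0 1 = ∅) :
    interior ((fun z : Pt d × ℝ => (1 + z.2) • z.1) '' (K ×ˢ Icc (0 : ℝ) 1)) = ∅ := by
  generalize hA : (fun z : Pt d × ℝ => (1 + z.2) • z.1) '' (K ×ˢ Icc (0 : ℝ) 1) = A
  rw [eq_empty_iff_forall_notMem]
  intro w hw
  have hwA := interior_subset hw
  rw [← hA] at hwA
  obtain ⟨⟨u, t⟩, ⟨hu, ht⟩, rfl⟩ := hwA
  simp only at hu ht hw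
  have h1 := hint ((fun v : Pt d => (1 + t) • v) ⁻¹' interior A)
    (isOpen_interior.preimage (by fun_prop)) (by
      rintro v ⟨hv, hv1⟩
      have hvA : (1 + t) • v ∈ A := interior_subset hv
      rw [← hA] at hvA
      obtain ⟨⟨u', t'⟩, ⟨hu', ht'⟩, he⟩ := hvA
      simp only at hu' ht' he
      have hn := congrArg norm he
      rw [norm_smul, norm_smul, mem_sphere_zero_iff_norm.1 hv1,
        mem_sphere_zero_iff_norm.1 (hK hu'), mul_one, mul_one,
        Real.norm_of_nonneg (by linarith [ht'.1]), Real.norm_of_nonneg (by linarith [ht.1])] at hn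
      rw [hn] at he
      rwa [← smul_right_injective (Pt d) (show (1 + t) ≠ 0 by linarith [ht.1]) he])
  exact (eq_empty_iff_forall_notMem.1 h1) u ⟨hw, hK hu⟩

/-- A nowhere dense compact subset of an embedded sphere bounding an embedded ball does not separate
a round ball. -/
theorem not_separated_ball {d : ℕ} {h : Pt d → Pt d} (hc : ContinuousOn h (closedBall 0 1))
    (hi : InjOn h (closedBall 0 1)) {K : Set (Pt d)} (hKc : IsCompact K) (hK : K ⊆ sphere 0 1)
    (hint : ∀ U : Set (Pt d), IsOpen U → U ∩ sphere 0 1 ⊆ K → U ∩ sphere 0 1 = ∅)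
    {x₀ : Pt d} {r : ℝ} {G₁ G₂ : Set (Pt d)} (hG₁ : IsOpen G₁) (hG₂ : IsOpen G₂)
    (hdis : Disjoint G₁ G₂) (hsub₁ : G₁ ⊆ ball x₀ r) (hsub₂ : G₂ ⊆ ball x₀ r)
    (hcov : ball x₀ r \ h '' K ⊆ G₁ ∪ G₂) {p q : Pt d} (hp : p ∈ G₁) (hq : q ∈ G₂) : False := by
  have hKB : K ⊆ closedBall 0 1 := hK.trans sphere_subset_closedBall
  obtain ⟨G, hG, hGh⟩ := exists_continuous_factor (isCompact_closedBall (0 : Pt d) 1) hc hi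
    continuous_id
  simp only [id_eq] at hGh
  have hhK : IsCompact (h '' K) := hKc.image_of_continuousOn (hc.mono hKB)
  have hC : IsCompact ((h '' K) ×ˢ Icc (0 : ℝ) 1) := hhK.prod isCompact_Icc
  have hjimg : (fun z : Pt d × ℝ => (1 + z.2) • G z.1) '' ((h '' K) ×ˢ Icc (0 : ℝ) 1) =
      (fun z : Pt d × ℝ => (1 + z.2) • z.1) '' (K ×ˢ Icc (0 : ℝ) 1) := by
    ext w
    constructor
    · rintro ⟨⟨_, t⟩, ⟨⟨u, hu, rfl⟩, ht⟩, rfl⟩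
      exact ⟨(u, t), ⟨hu, ht⟩, by simp [hGh u (hKB hu)]⟩
    · rintro ⟨⟨u, t⟩, ⟨hu, ht⟩, rfl⟩
      exact ⟨(h u, t), ⟨⟨u, hu, rfl⟩, ht⟩, by simp [hGh u (hKB hu)]⟩
  have hjinj : InjOn (fun z : Pt d × ℝ => (1 + z.2) • G z.1) ((h '' K) ×ˢ Icc (0 : ℝ) 1) := by
    rintro ⟨_, t⟩ ⟨⟨u, hu, rfl⟩, ht⟩ ⟨_, t'⟩ ⟨⟨u', hu', rfl⟩, ht'⟩ he
    simp only [hGh u (hKB hu), hGh u' (hKB hu')] at he ht ht'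
    have hn := congrArg norm he
    rw [norm_smul, norm_smul, mem_sphere_zero_iff_norm.1 (hK hu),
      mem_sphere_zero_iff_norm.1 (hK hu'), mul_one, mul_one,
      Real.norm_of_nonneg (by linarith [ht.1]), Real.norm_of_nonneg (by linarith [ht'.1])] at hn
    rw [hn] at he
    have hu : u = u' := smul_right_injective (Pt d) (show (1 + t') ≠ 0 by linarith [ht'.1]) he
    rw [hu, add_left_cancel hn]
  obtain ⟨δ₁, hδ₁, hpδ⟩ := Metric.isOpen_iff.1 hG₁ p hp
  obtain ⟨δ₂, hδ₂, hqδ⟩ := Metric.isOpen_iff.1 hG₂ q hq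
  obtain ⟨δ, hδ, hδp, hδq, hδU⟩ : ∃ δ > 0, (∀ x, x ∉ G₁ → δ ≤ ‖x - p‖) ∧
      (∀ x, x ∉ G₂ → δ ≤ ‖x - q‖) ∧
      ∀ x, x ∉ ball x₀ r → ∀ t ∈ Icc (0 : ℝ) 1, δ ≤ ‖x - AffineMap.lineMap p q t‖ := by
    have hpr := mem_ball.1 (hsub₁ hp)
    have hqr := mem_ball.1 (hsub₂ hq)
    refine ⟨min (min δ₁ δ₂) (r - max (dist p x₀) (dist q x₀)),
      lt_min (lt_min hδ₁ hδ₂) (sub_pos.2 (max_lt hpr hqr)), fun x hx => ?_, fun x hx => ?_,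
      fun x hx t ht => ?_⟩
    · by_contra! hlt
      exact hx (hpδ (mem_ball_iff_norm.2
        (hlt.trans_le ((min_le_left _ _).trans (min_le_left _ _)))))
    · by_contra! hlt
      exact hx (hqδ (mem_ball_iff_norm.2
        (hlt.trans_le ((min_le_left _ _).trans (min_le_right _ _)))))
    · have hmem : AffineMap.lineMap p q t ∈ closedBall x₀ (max (dist p x₀) (dist q x₀)) :=
        (convex_closedBall x₀ _).lineMap_mem (mem_closedBall.2 (le_max_left _ _))
          (mem_closedBall.2 (le_max_right _ _)) ht
      rw [mem_ball, not_lt] at hx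
      have h1 := dist_triangle x (AffineMap.lineMap p q t) x₀
      rw [dist_eq_norm x (AffineMap.lineMap p q t)] at h1
      have h2 := mem_closedBall.1 hmem
      exact (min_le_right _ _).trans (by linarith)
  have hΘ : Continuous fun z : Pt d × ℝ => z.1 - AffineMap.lineMap p q z.2 := by
    simp only [AffineMap.lineMap_apply_module]
    fun_prop
  obtain ⟨Ψ, hΨ, hΨΘ, hΨ0, -⟩ := exists_continuous_avoiding_zero hC
    (j := fun z : Pt d × ℝ => (1 + z.2) • G z.1) (by fun_prop) hjinj
    (by rw [hjimg]; exact interior_shell_eq_empty hK hint) hΘ hδ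
  have hZ : IsCompact ((closure G₁ ×ˢ Icc (0 : ℝ) 1) ∩ {z | Ψ z = 0}) :=
    (((isCompact_closedBall x₀ r).of_isClosed_subset isClosed_closure
      ((closure_mono hsub₁).trans closure_ball_subset_closedBall)).prod isCompact_Icc).inter_right
      (isClosed_eq hΨ continuous_const)
  have hne : G₁ᶜ.Nonempty := ⟨q, fun hq' => disjoint_left.1 hdis hq' hq⟩
  obtain ⟨m, hm, hmZ⟩ := hZ.exists_forall_le' (a := (0 : ℝ))
    (f := fun z => infDist z.1 G₁ᶜ) (by fun_prop) (by
    rintro ⟨x, t⟩ ⟨⟨hx, ht⟩, hx0⟩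
    refine (hG₁.isClosed_compl.notMem_iff_infDist_pos hne).1 fun hxG => ?_
    simp only at hx ht hxG
    by_cases hxU : x ∈ ball x₀ r
    · have hx2 : x ∉ G₂ := disjoint_left.1 (hdis.closure_left hG₂) hx
      have hxK : x ∈ h '' K := by
        by_contra hxK
        exact (hcov ⟨hxU, hxK⟩).elim hxG hx2
      exact hΨ0 (x, t) ⟨hxK, ht⟩ hx0
    · have h1 := hδU x hxU t ht
      have h2 : x - AffineMap.lineMap p q t = 0 := (hΨΘ (x, t) h1).symm.trans hx0
      rw [h2, norm_zero] at h1
      linarith)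
  let l : Pt d → ℝ := fun x => min 1 (infDist x G₁ᶜ / m)
  have hl : Continuous l := by fun_prop
  have hl01 : ∀ x, l x ∈ Icc (0 : ℝ) 1 := fun x =>
    ⟨le_min zero_le_one (div_nonneg infDist_nonneg hm.le), min_le_left _ _⟩
  have hoff : ∀ x, x ∉ G₁ → Ψ (x, l x) = x - p := by
    intro x hx
    have h0 : l x = 0 := by
      simp only [l]
      rw [infDist_zero_of_mem (show x ∈ G₁ᶜ from hx), zero_div, min_eq_right zero_le_one]
    have h1 := hΨΘ (x, l x)
    rw [h0] at h1 ⊢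
    simp only [AffineMap.lineMap_apply_zero] at h1
    exact h1 (hδp x hx)
  obtain ⟨y, hy⟩ := exists_zero_of_eq_id_of_le_norm (fun y => Ψ (y + p, l (y + p))) (by fun_prop)
    (r + ‖x₀ - p‖) (fun y hy => by
      rw [hoff _ (fun hG => ?_), add_sub_cancel_right]
      have h1 := mem_ball_iff_norm.1 (hsub₁ hG)
      have h2 : ‖y‖ ≤ ‖y + p - x₀‖ + ‖x₀ - p‖ := by
        calc ‖y‖ = ‖(y + p - x₀) + (x₀ - p)‖ := by congr 1; abel
          _ ≤ _ := norm_add_le _ _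
      linarith)
  generalize y + p = x at hy
  by_cases hx : x ∈ G₁
  · have h1 : m ≤ infDist x G₁ᶜ := hmZ (x, l x) ⟨⟨subset_closure hx, hl01 x⟩, hy⟩
    have h2 : l x = 1 := min_eq_left ((one_le_div hm).2 h1)
    have hx2 : x ∉ G₂ := disjoint_left.1 hdis hx
    have h3 := hΨΘ (x, l x)
    rw [hy, h2] at h3
    simp only [AffineMap.lineMap_apply_one] at h3
    have h4 := h3 (hδq x hx2)
    exact hx2 (sub_eq_zero.1 h4.symm ▸ hq)
  · rw [hoff x hx, sub_eq_zero] at hy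
    exact hx (hy ▸ hp)

/-- Removing a nowhere dense closed subset of an embedded sphere bounding an embedded ball does not
disconnect an open set. -/
theorem isPreconnected_diff_of_subset_image_sphere {d : ℕ} {h : Pt d → Pt d}
    (hc : ContinuousOn h (closedBall 0 1)) (hi : InjOn h (closedBall 0 1)) {O Z : Set (Pt d)}
    (hO : IsOpen O) (hOc : IsPreconnected O) (hZ : IsClosed Z) (hZh : Z ⊆ h '' sphere 0 1)
    (hint : ∀ U : Set (Pt d), IsOpen U → U ⊆ O → U ∩ h '' sphere 0 1 ⊆ Z →
      U ∩ h '' sphere 0 1 = ∅) : IsPreconnected (O \ Z) := by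
  have hSB : sphere (0 : Pt d) 1 ⊆ closedBall 0 1 := sphere_subset_closedBall
  obtain ⟨G, hG, hGh⟩ := exists_continuous_factor (isCompact_closedBall (0 : Pt d) 1) hc hi
    continuous_id
  simp only [id_eq] at hGh
  have hOZ : IsOpen (O \ Z) := hO.sdiff hZ
  intro u v hu hv huv hune hvne
  by_contra hcon
  have key : ∀ x ∈ O, ∃ r > 0, ball x r \ Z ⊆ (O \ Z) ∩ u ∨ ball x r \ Z ⊆ (O \ Z) ∩ v := by
    intro x hx
    obtain ⟨r, hr, hrO⟩ := Metric.nhds_basis_closedBall.mem_iff.1 (hO.mem_nhds hx)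
    refine ⟨r, hr, ?_⟩
    have hbO : ball x r ⊆ O := ball_subset_closedBall.trans hrO
    have hKc : IsCompact (G '' (Z ∩ closedBall x r)) :=
      ((isCompact_closedBall x r).inter_left hZ).image hG
    have hGS : ∀ y ∈ Z, G y ∈ sphere (0 : Pt d) 1 ∧ h (G y) = y := by
      intro y hy
      obtain ⟨s, hs, rfl⟩ := hZh hy
      rw [hGh s (hSB hs)]
      exact ⟨hs, rfl⟩
    have hKint : ∀ U : Set (Pt d), IsOpen U → U ∩ sphere 0 1 ⊆ G '' (Z ∩ closedBall x r) →
        U ∩ sphere 0 1 = ∅ := by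
      intro U hU hUK
      have hmem : ∀ s ∈ U ∩ sphere 0 1, h s ∈ Z ∩ closedBall x r := by
        intro s hs
        obtain ⟨y, hy, rfl⟩ := hUK hs
        rwa [(hGS y hy.1).2]
      have h1 := hint (G ⁻¹' U ∩ O) ((hU.preimage hG).inter hO) inter_subset_right (by
        rintro _ ⟨⟨hyU, -⟩, s, hs, rfl⟩
        rw [mem_preimage, hGh s (hSB hs)] at hyU
        exact (hmem s ⟨hyU, hs⟩).1)
      rw [eq_empty_iff_forall_notMem] at h1 ⊢
      intro s hs
      refine h1 (h s) ⟨⟨?_, hrO (hmem s hs).2⟩, s, hs.2, rfl⟩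
      rw [mem_preimage, hGh s (hSB hs.2)]
      exact hs.1
    have hcov : ball x r \ Z ⊆ (O \ Z) ∩ u ∪ (O \ Z) ∩ v := by
      intro y hy
      have hy' : y ∈ O \ Z := ⟨hbO hy.1, hy.2⟩
      exact (huv hy').imp (fun h => ⟨hy', h⟩) fun h => ⟨hy', h⟩
    by_contra! hnot
    obtain ⟨q, hq, hq1⟩ := not_subset.1 hnot.1
    obtain ⟨p, hp, hp1⟩ := not_subset.1 hnot.2
    refine not_separated_ball hc hi hKc (by
      rintro _ ⟨y, hy, rfl⟩
      exact (hGS y hy.1).1) hKint (hOZ.inter hu |>.inter isOpen_ball)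
      (hOZ.inter hv |>.inter isOpen_ball) ?_ inter_subset_right inter_subset_right ?_
      ⟨(hcov hp).resolve_right hp1, hp.1⟩ ⟨(hcov hq).resolve_left hq1, hq.1⟩
    · rw [disjoint_left]
      exact fun y hy hy' => hcon ⟨y, hy.1.1, hy.1.2, hy'.1.2⟩
    · rintro y ⟨hy, hyK⟩
      have hyZ : y ∉ Z := fun hyZ => hyK
        ⟨G y, ⟨y, ⟨hyZ, ball_subset_closedBall hy⟩, rfl⟩, (hGS y hyZ).2⟩
      exact (hcov ⟨hy, hyZ⟩).imp (fun h => ⟨h, hy⟩) fun h => ⟨h, hy⟩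
  have hopen : ∀ A : Set (Pt d), IsOpen {x | ∃ r > 0, ball x r \ Z ⊆ A} := by
    intro A
    rw [Metric.isOpen_iff]
    rintro x ⟨r, hr, hrA⟩
    refine ⟨r, hr, fun y hy => ?_⟩
    obtain ⟨r', hr', hsub⟩ := Metric.isOpen_iff.1 isOpen_ball y hy
    exact ⟨r', hr', (sdiff_subset_sdiff_left hsub).trans hrA⟩
  have hself : ∀ A : Set (Pt d), IsOpen A → A ⊆ {x | ∃ r > 0, ball x r \ Z ⊆ A} := by
    intro A hA x hx
    obtain ⟨r, hr, hrA⟩ := Metric.isOpen_iff.1 hA x hx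
    exact ⟨r, hr, sdiff_subset.trans hrA⟩
  obtain ⟨x, hxO, ⟨r₁, hr₁, h₁⟩, r₂, hr₂, h₂⟩ := hOc _ _ (hopen ((O \ Z) ∩ u))
    (hopen ((O \ Z) ∩ v)) (fun x hx => by
      obtain ⟨r, hr, h1 | h1⟩ := key x hx
      · exact Or.inl ⟨r, hr, h1⟩
      · exact Or.inr ⟨r, hr, h1⟩)
    (hune.mono fun x hx => ⟨hx.1.1, hself _ (hOZ.inter hu) hx⟩)
    (hvne.mono fun x hx => ⟨hx.1.1, hself _ (hOZ.inter hv) hx⟩)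
  have hsubZ : ball x (min r₁ r₂) ⊆ Z := by
    intro y hy
    by_contra hyZ
    exact hcon ⟨y, (h₁ ⟨ball_subset_ball (min_le_left _ _) hy, hyZ⟩).1,
      (h₁ ⟨ball_subset_ball (min_le_left _ _) hy, hyZ⟩).2,
      (h₂ ⟨ball_subset_ball (min_le_right _ _) hy, hyZ⟩).2⟩
  have hx : x ∈ ball x (min r₁ r₂) := mem_ball_self (lt_min hr₁ hr₂)
  have h1 := hint (ball x (min r₁ r₂) ∩ O) (isOpen_ball.inter hO) inter_subset_right
    fun y hy => hsubZ hy.1.1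
  exact (eq_empty_iff_forall_notMem.1 h1) x ⟨⟨hx, hxO⟩, hZh (hsubZ hx)⟩

theorem exists_injOn_closedBall_of_homeomorph {d : ℕ} {A : Set (Pt d)}
    (e : A ≃ₜ closedBall (0 : Pt d) 1) :
    ∃ h : Pt d → Pt d, Continuous h ∧ InjOn h (closedBall 0 1) ∧ h '' closedBall 0 1 = A := by
  classical
  let f : Pt d → Pt d := fun x => if hx : x ∈ closedBall (0 : Pt d) 1 then e.symm ⟨x, hx⟩ else 0
  have hfe : ∀ x (hx : x ∈ closedBall (0 : Pt d) 1), f x = e.symm ⟨x, hx⟩ := fun x hx => dif_pos hx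
  have hf : ContinuousOn f (closedBall 0 1) := by
    rw [continuousOn_iff_continuous_domRestrict]
    have : (closedBall (0 : Pt d) 1).domRestrict f = fun x => (e.symm x : Pt d) := by
      ext1 x
      rw [Set.domRestrict_apply, hfe x.1 x.2]
    rw [this]
    exact continuous_subtype_val.comp e.symm.continuous
  obtain ⟨h, hh, hhf⟩ := exists_continuous_extension isClosed_closedBall hf
  refine ⟨h, hh, fun x hx y hy hxy => ?_, ?_⟩
  · rw [hhf hx, hhf hy, hfe x hx, hfe y hy] at hxy
    exact congrArg Subtype.val (e.symm.injective (Subtype.ext hxy))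
  · rw [hhf.image_eq]
    ext y
    constructor
    · rintro ⟨x, hx, rfl⟩
      rw [hfe x hx]
      exact (e.symm _).2
    · intro hy
      refine ⟨e ⟨y, hy⟩, (e ⟨y, hy⟩).2, ?_⟩
      rw [hfe _ (e ⟨y, hy⟩).2]
      simp

theorem interior_image_closedBall {d : ℕ} {h : Pt d → Pt d} (hc : Continuous h)
    (hi : InjOn h (closedBall 0 1)) : interior (h '' closedBall 0 1) = h '' ball 0 1 := by
  apply Subset.antisymm
  · obtain ⟨G, hG, hGh⟩ := exists_continuous_factor (isCompact_closedBall (0 : Pt d) 1)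
      hc.continuousOn hi continuous_id
    simp only [id_eq] at hGh
    have hopen : IsOpen (G '' interior (h '' closedBall 0 1)) := by
      refine isOpen_image_of_continuousOn_of_injOn isOpen_interior hG.continuousOn ?_
      intro y hy z hz hyz
      obtain ⟨s, hs, rfl⟩ := interior_subset hy
      obtain ⟨t, ht, rfl⟩ := interior_subset hz
      rw [hGh s hs, hGh t ht] at hyz
      rw [hyz]
    have hsub : G '' interior (h '' closedBall 0 1) ⊆ closedBall 0 1 := by
      rintro _ ⟨y, hy, rfl⟩
      obtain ⟨s, hs, rfl⟩ := interior_subset hy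
      rwa [hGh s hs]
    intro y hy
    have h1 : G y ∈ interior (closedBall (0 : Pt d) 1) :=
      interior_maximal hsub hopen (mem_image_of_mem G hy)
    rw [interior_closedBall _ one_ne_zero] at h1
    obtain ⟨s, hs, rfl⟩ := interior_subset hy
    rw [hGh s hs] at h1
    exact mem_image_of_mem h h1
  · exact interior_maximal (image_mono ball_subset_closedBall)
      (isOpen_image_of_continuousOn_of_injOn isOpen_ball hc.continuousOn
        (hi.mono ball_subset_closedBall))

theorem isClosed_image_closedBall {d : ℕ} {h : Pt d → Pt d} (hc : Continuous h) :
    IsClosed (h '' closedBall 0 1) :=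
  ((isCompact_closedBall 0 1).image hc).isClosed

theorem image_closedBall_subset_closure {d : ℕ} {h : Pt d → Pt d} (hc : Continuous h) :
    h '' closedBall 0 1 ⊆ closure (h '' ball 0 1) := by
  rw [← closure_ball (0 : Pt d) one_ne_zero]
  exact image_closure_subset_closure_image hc

theorem image_closedBall_diff_image_ball {d : ℕ} {h : Pt d → Pt d}
    (hi : InjOn h (closedBall 0 1)) :
    h '' closedBall 0 1 \ h '' ball 0 1 = h '' sphere 0 1 := by
  rw [← hi.image_sdiff_subset ball_subset_closedBall, closedBall_sdiff_ball]

/-- Two embedded balls with disjoint interiors which share a relatively open piece of their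
boundaries have that piece in the interior of their union. -/
theorem exists_mem_interior_union {d : ℕ} {h k : Pt d → Pt d} (hc : Continuous h)
    (hi : InjOn h (closedBall 0 1)) (kc : Continuous k) (ki : InjOn k (closedBall 0 1))
    (hdis : Disjoint (h '' closedBall 0 1) (k '' ball 0 1)) {W : Set (Pt d)} (hW : IsOpen W)
    (hWk : W ∩ h '' sphere 0 1 ⊆ k '' sphere 0 1) {w : Pt d} (hw : w ∈ W ∩ h '' sphere 0 1) :
    w ∈ interior (h '' closedBall 0 1 ∪ k '' closedBall 0 1) := by
  obtain ⟨hwW, u, hu, rfl⟩ := hw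
  have hSB : sphere (0 : Pt d) 1 ⊆ closedBall 0 1 := sphere_subset_closedBall
  obtain ⟨L, hL, hLk⟩ := exists_continuous_factor (isCompact_closedBall (0 : Pt d) 1)
    kc.continuousOn ki continuous_id
  simp only [id_eq] at hLk
  have hLS : ∀ s ∈ sphere (0 : Pt d) 1, h s ∈ W → L (h s) ∈ sphere (0 : Pt d) 1 ∧
      k (L (h s)) = h s := by
    intro s hs hsW
    obtain ⟨t, ht, hts⟩ := hWk ⟨hsW, s, hs, rfl⟩
    rw [← hts, hLk t (hSB ht)]
    exact ⟨ht, rfl⟩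
  let E : Set (Pt d) := {x | ‖x‖ < 2} ∩ ({x | x ≠ 0} ∩ (fun x => h (‖x‖⁻¹ • x)) ⁻¹' W)
  have hcont : ContinuousOn (fun x : Pt d => h (‖x‖⁻¹ • x)) {x | x ≠ 0} :=
    hc.comp_continuousOn ((continuousOn_id.norm.inv₀ fun x hx => norm_ne_zero_iff.2 hx).smul
      continuousOn_id)
  have hE : IsOpen E := (isOpen_lt continuous_norm continuous_const).inter
    (hcont.isOpen_inter_preimage isOpen_ne hW)
  have hu1 : ‖u‖ = 1 := mem_sphere_zero_iff_norm.1 hu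
  have huE : u ∈ E := by
    refine ⟨?_, ?_, ?_⟩
    · change ‖u‖ < 2
      rw [hu1]; norm_num
    · change u ≠ 0
      rw [← norm_ne_zero_iff, hu1]; norm_num
    · change h (‖u‖⁻¹ • u) ∈ W
      rwa [hu1, inv_one, one_smul]
  have hnE : ∀ x ∈ E, ‖x‖⁻¹ • x ∈ sphere (0 : Pt d) 1 := fun x hx => by
    rw [mem_sphere_zero_iff_norm]
    exact norm_smul_inv_norm (𝕜 := ℝ) hx.2.1
  let q : Pt d → Pt d := fun x => (2 - ‖x‖) • L (h (‖x‖⁻¹ • x))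
  have hqn : ∀ x ∈ E, ‖q x‖ = 2 - ‖x‖ := by
    intro x hx
    have h2 : ‖x‖ < 2 := hx.1
    rw [norm_smul, mem_sphere_zero_iff_norm.1 (hLS _ (hnE x hx) hx.2.2).1, mul_one,
      Real.norm_of_nonneg (by linarith)]
  let Ψ : Pt d → Pt d := fun x => if ‖x‖ ≤ 1 then h x else k (q x)
  have hΨc : ContinuousOn Ψ E := by
    have hq : ContinuousOn q E := ((continuous_const.sub continuous_norm).continuousOn).smul
      (hL.comp_continuousOn (hcont.mono fun x hx => hx.2.1))
    rw [continuousOn_iff_continuous_domRestrict]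
    refine Continuous.if_le (hc.comp continuous_subtype_val)
      (kc.comp (continuousOn_iff_continuous_domRestrict.1 hq)) (continuous_norm.comp
      continuous_subtype_val) continuous_const ?_
    rintro ⟨x, hx⟩ hx1
    simp only at hx1
    have h1 := hnE x hx
    have h2 : h (‖x‖⁻¹ • x) ∈ W := hx.2.2
    simp only [q, hx1]
    rw [hx1, inv_one, one_smul] at h1 h2
    rw [inv_one, one_smul, show (2 : ℝ) - 1 = 1 by norm_num, one_smul, (hLS x h1 h2).2]
  have hmem : ∀ x ∈ E, (‖x‖ ≤ 1 ∧ Ψ x = h x ∧ x ∈ closedBall (0 : Pt d) 1) ∨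
      (1 < ‖x‖ ∧ Ψ x = k (q x) ∧ q x ∈ ball (0 : Pt d) 1) := by
    intro x hx
    rcases le_or_gt ‖x‖ 1 with h1 | h1
    · exact Or.inl ⟨h1, if_pos h1, mem_closedBall_zero_iff.2 h1⟩
    · refine Or.inr ⟨h1, if_neg (not_le.2 h1), ?_⟩
      rw [mem_ball_zero_iff, hqn x hx]
      linarith
  have hΨi : InjOn Ψ E := by
    intro x hx y hy hxy
    rcases hmem x hx with ⟨hx1, hx2, hx3⟩ | ⟨hx1, hx2, hx3⟩ <;>
      rcases hmem y hy with ⟨hy1, hy2, hy3⟩ | ⟨hy1, hy2, hy3⟩ <;> rw [hx2, hy2] at hxy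
    · exact hi hx3 hy3 hxy
    · exact absurd ⟨_, hy3, rfl⟩ (disjoint_left.1 hdis ⟨x, hx3, hxy⟩)
    · exact absurd ⟨_, hx3, rfl⟩ (disjoint_left.1 hdis ⟨y, hy3, hxy.symm⟩)
    · have hq := ki (ball_subset_closedBall hx3) (ball_subset_closedBall hy3) hxy
      have hn : ‖x‖ = ‖y‖ := by
        have := congrArg norm hq
        rw [hqn x hx, hqn y hy] at this
        linarith
      have hy2' : ‖y‖ < 2 := hy.1
      simp only [q] at hq
      rw [hn] at hq
      have h3 := congrArg k (smul_right_injective (Pt d)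
        (show (2 - ‖y‖) ≠ 0 by linarith) hq)
      have h4 := hnE x hx
      have h5 := (hLS _ h4 hx.2.2).2
      rw [hn] at h4 h5
      rw [h5, (hLS _ (hnE y hy) hy.2.2).2] at h3
      exact smul_right_injective (Pt d) (inv_ne_zero (norm_ne_zero_iff.2 hy.2.1))
        (hi (hSB h4) (hSB (hnE y hy)) h3)
  refine interior_maximal ?_ (isOpen_image_of_continuousOn_of_injOn hE hΨc hΨi)
    ⟨u, huE, if_pos hu1.le⟩
  rintro _ ⟨x, hx, rfl⟩
  rcases hmem x hx with ⟨-, hx2, hx3⟩ | ⟨-, hx2, hx3⟩ <;> rw [hx2]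
  · exact Or.inl ⟨x, hx3, rfl⟩
  · exact Or.inr ⟨_, ball_subset_closedBall hx3, rfl⟩

theorem frontier_image_closedBall {d : ℕ} {h : Pt d → Pt d} (hc : Continuous h)
    (hi : InjOn h (closedBall 0 1)) : frontier (h '' closedBall 0 1) = h '' sphere 0 1 := by
  rw [(isClosed_image_closedBall hc).frontier_eq, interior_image_closedBall hc hi,
    image_closedBall_diff_image_ball hi]

/-- `A` is the image of an embedding of the closed unit ball. -/
def IsEmbeddedBall {d : ℕ} (A : Set (Pt d)) : Prop :=
  ∃ h : Pt d → Pt d, Continuous h ∧ InjOn h (closedBall 0 1) ∧ h '' closedBall 0 1 = A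

namespace IsEmbeddedBall

variable {d : ℕ} {A : Set (Pt d)}

theorem isClosed (hA : IsEmbeddedBall A) : IsClosed A := by
  obtain ⟨h, hc, -, rfl⟩ := hA
  exact isClosed_image_closedBall hc

theorem subset_closure_interior (hA : IsEmbeddedBall A) : A ⊆ closure (interior A) := by
  obtain ⟨h, hc, hi, rfl⟩ := hA
  rw [interior_image_closedBall hc hi]
  exact image_closedBall_subset_closure hc

theorem isConnected_interior (hA : IsEmbeddedBall A) : IsConnected (interior A) := by
  obtain ⟨h, hc, hi, rfl⟩ := hA
  rw [interior_image_closedBall hc hi]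
  exact ((convex_ball (0 : Pt d) 1).isConnected ⟨0, mem_ball_self one_pos⟩).image h hc.continuousOn

theorem disjoint_interior (hA : IsEmbeddedBall A) {B : Set (Pt d)}
    (hdis : Disjoint (interior A) (interior B)) : Disjoint A (interior B) :=
  (hdis.closure_left isOpen_interior).mono_left hA.subset_closure_interior

end IsEmbeddedBall

section PartialTiling

variable {d : ℕ} {ι : Type*} {P : Finset ι} {c : ι → Set (Pt d)}

theorem inter_frontier_eq_empty_of_disjoint_interior_union (hball : ∀ i ∈ P, IsEmbeddedBall (c i))
    (hdis : ∀ i ∈ P, ∀ j ∈ P, i ≠ j → Disjoint (interior (c i)) (interior (c j)))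
    {a : ι} (ha : a ∈ P) {U : Set (Pt d)} (hU : IsOpen U) (hUP : U ⊆ ⋃ i ∈ P, c i)
    (hUd : ∀ i ∈ P, Disjoint (U ∩ frontier (c a)) (interior (c a ∪ c i))) :
    U ∩ frontier (c a) = ∅ := by
  classical
  by_contra hne
  rw [← ne_eq, ← nonempty_iff_ne_empty] at hne
  have hcov : U ∩ frontier (c a) ⊆ ⋃ b ∈ P.erase a, c b := by
    rintro y ⟨hyU, hya⟩
    by_contra hyb
    have hcl : IsClosed (⋃ b ∈ P.erase a, c b) := isClosed_biUnion_finset fun b hb =>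
      (hball b (Finset.mem_of_mem_erase hb)).isClosed
    refine hya.2 (interior_maximal (s := c a) (t := U ∩ (⋃ b ∈ P.erase a, c b)ᶜ) ?_
      (hU.inter hcl.isOpen_compl) ⟨hyU, hyb⟩)
    rintro z ⟨hzU, hzb⟩
    obtain ⟨i, hi, hzi⟩ := mem_iUnion₂.1 (hUP hzU)
    by_cases hia : i = a
    · exact hia ▸ hzi
    · exact absurd (mem_iUnion₂.2 ⟨i, Finset.mem_erase.2 ⟨hia, hi⟩, hzi⟩) hzb
  obtain ⟨b, hb, x, hxU, hxb⟩ := exists_interior_nonempty_of_subset_biUnion (P.erase a)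
    (fun b => ((↑) : frontier (c a) → Pt d) ⁻¹' c b)
    (fun b hb => (hball b (Finset.mem_of_mem_erase hb)).isClosed.preimage continuous_subtype_val)
    (hU.preimage continuous_subtype_val)
    (by obtain ⟨y, hy⟩ := hne; exact ⟨⟨y, hy.2⟩, hy.1⟩)
    (fun y hy => by
      obtain ⟨b, hb, hyb⟩ := mem_iUnion₂.1 (hcov ⟨hy, y.2⟩)
      exact mem_iUnion₂.2 ⟨b, hb, hyb⟩)
  obtain ⟨hba, hbP⟩ := Finset.mem_erase.1 hb
  obtain ⟨T, hT, hTo, hxT⟩ := mem_interior.1 hxb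
  obtain ⟨W, hW, rfl⟩ := isOpen_induced_iff.1 hTo
  have hadis := (hball a ha).disjoint_interior (hdis a ha b hbP hba.symm)
  have hUa := hUd b hbP
  have hxf := x.2
  have hTb : W ∩ frontier (c a) ⊆ c b := fun y hy => hT (a := ⟨y, hy.2⟩) hy.1
  obtain ⟨h, hc, hi, hha⟩ := hball a ha
  obtain ⟨k, kc, ki, hkb⟩ := hball b hbP
  have hfr : frontier (c a) = h '' sphere 0 1 := hha ▸ frontier_image_closedBall hc hi
  have hxh : (x : Pt d) ∈ h '' sphere 0 1 := hfr ▸ hxf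
  rw [hfr] at hTb
  rw [← hkb, interior_image_closedBall kc ki, ← hha] at hadis
  have hmem := exists_mem_interior_union hc hi kc ki hadis hW (by
    rw [← image_closedBall_diff_image_ball ki, hkb]
    exact fun y hy => ⟨hTb hy, fun hyk => disjoint_left.1 hadis
      (image_mono sphere_subset_closedBall hy.2) hyk⟩) (w := x) ⟨hxT, hxh⟩
  rw [hha, hkb] at hmem
  exact disjoint_left.1 hUa ⟨hxU, x.2⟩ hmem

theorem isPreconnected_biUnion_interior_union (hball : ∀ i ∈ P, IsEmbeddedBall (c i))
    (hdis : ∀ i ∈ P, ∀ j ∈ P, i ≠ j → Disjoint (interior (c i)) (interior (c j)))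
    (hconn : IsPreconnected (interior (⋃ i ∈ P, c i))) :
    IsPreconnected (⋃ i ∈ P, ⋃ j ∈ P, interior (c i ∪ c j)) := by
  classical
  have hGo : IsOpen (⋃ i ∈ P, ⋃ j ∈ P, interior (c i ∪ c j)) :=
    isOpen_biUnion fun i _ => isOpen_biUnion fun j _ => isOpen_interior
  generalize hG : (⋃ i ∈ P, ⋃ j ∈ P, interior (c i ∪ c j)) = G at hGo
  have hGmem : ∀ i ∈ P, ∀ j ∈ P, interior (c i ∪ c j) ⊆ G := fun i hi j hj => by
    rw [← hG]
    exact subset_iUnion₂_of_subset i hi (subset_iUnion₂_of_subset j hj Subset.rfl)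
  have hcl : ∀ a, IsClosed (frontier (c a) \ G) := fun a => isClosed_frontier.sdiff hGo
  have hstep : ∀ F ⊆ P, IsPreconnected (interior (⋃ i ∈ P, c i) \ ⋃ a ∈ F, frontier (c a) \ G) := by
    intro F
    induction F using Finset.induction_on with
    | empty => simpa using hconn
    | insert a F haF ih =>
      intro hF
      have haP : a ∈ P := hF (Finset.mem_insert_self _ _)
      obtain ⟨h, hc, hi, hha⟩ := hball a haP
      have hfr : frontier (c a) = h '' sphere 0 1 := hha ▸ frontier_image_closedBall hc hi
      rw [Finset.set_biUnion_insert, union_comm, ← sdiff_sdiff]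
      refine isPreconnected_diff_of_subset_image_sphere hc.continuousOn hi
        (isOpen_interior.sdiff (isClosed_biUnion_finset fun b _ => hcl b))
        (ih ((Finset.subset_insert _ _).trans hF)) (hcl a) (hfr ▸ sdiff_subset)
        fun U hU hUO hUZ => ?_
      rw [← hfr] at hUZ ⊢
      exact inter_frontier_eq_empty_of_disjoint_interior_union hball hdis haP hU
        (hUO.trans (sdiff_subset.trans interior_subset)) fun i hi =>
        disjoint_left.2 fun y hy hyi => (hUZ hy).2 (hGmem a haP i hi hyi)
  convert hstep P Subset.rfl using 1
  apply Subset.antisymm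
  · intro x hx
    refine ⟨?_, fun hxb => ?_⟩
    · rw [← hG] at hx
      simp only [mem_iUnion] at hx
      obtain ⟨i, hi, j, hj, hx⟩ := hx
      exact interior_mono (union_subset (subset_biUnion_of_mem (u := c) hi)
        (subset_biUnion_of_mem (u := c) hj)) hx
    · simp only [mem_iUnion] at hxb
      obtain ⟨a, -, hxa⟩ := hxb
      exact hxa.2 hx
  · rintro x ⟨hx, hxb⟩
    have hx' := interior_subset hx
    simp only [mem_iUnion] at hx' hxb
    obtain ⟨a, ha, hxa⟩ := hx'
    by_contra hxG
    refine hxb ⟨a, ha, ⟨subset_closure hxa, fun hxi => hxG (hGmem a ha a ha ?_)⟩, hxG⟩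
    rwa [union_self]

end PartialTiling

theorem interior_union_subset_of_not_isConnected {d : ℕ} {A B : Set (Pt d)}
    (hA : IsEmbeddedBall A) (hB : IsEmbeddedBall B) (hAB : ¬ IsConnected (interior (A ∪ B))) :
    interior (A ∪ B) ⊆ interior A ∪ interior B := by
  intro y hy
  by_contra hyAB
  rw [mem_union, not_or] at hyAB
  have hyA : y ∈ A := by
    by_contra hyA
    refine hyAB.2 (interior_maximal ?_ (isOpen_interior.inter hA.isClosed.isOpen_compl) ⟨hy, hyA⟩)
    exact fun z hz => (interior_subset hz.1).resolve_left hz.2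
  have hyB : y ∈ B := by
    by_contra hyB
    refine hyAB.1 (interior_maximal ?_ (isOpen_interior.inter hB.isClosed.isOpen_compl) ⟨hy, hyB⟩)
    exact fun z hz => (interior_subset hz.1).resolve_right hz.2
  have hins : ∀ {C : Set (Pt d)}, IsEmbeddedBall C → y ∈ C → IsConnected (insert y (interior C)) :=
    fun hC hyC => hC.isConnected_interior.subset_closure (subset_insert _ _)
      (insert_subset (hC.subset_closure_interior hyC) subset_closure)
  have hT := (hins hA hyA).union ⟨y, mem_insert _ _, mem_insert _ _⟩ (hins hB hyB)
  refine hAB (hT.subset_closure ?_ ?_)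
  · exact union_subset (insert_subset hy (interior_mono subset_union_left))
      (insert_subset hy (interior_mono subset_union_right))
  · refine interior_subset.trans (union_subset ?_ ?_)
    · exact hA.subset_closure_interior.trans (closure_mono
        ((subset_insert _ _).trans subset_union_left))
    · exact hB.subset_closure_interior.trans (closure_mono
        ((subset_insert _ _).trans subset_union_right))

theorem reflTransGen_of_isPreconnected_interior_biUnion {d : ℕ} {ι : Type*} {P : Finset ι}
    {c : ι → Set (Pt d)} (hball : ∀ i ∈ P, IsEmbeddedBall (c i))
    (hdis : ∀ i ∈ P, ∀ j ∈ P, i ≠ j → Disjoint (interior (c i)) (interior (c j)))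
    (hconn : IsPreconnected (interior (⋃ i ∈ P, c i))) {a b : ι} (ha : a ∈ P) (hb : b ∈ P) :
    Relation.ReflTransGen (fun i j => i ∈ P ∧ j ∈ P ∧ IsConnected (interior (c i ∪ c j))) a b := by
  by_contra hab
  have hpre := isPreconnected_biUnion_interior_union hball hdis hconn
  have hR : ∀ i ∈ P, ∀ j ∈ P, Relation.ReflTransGen
      (fun i j => i ∈ P ∧ j ∈ P ∧ IsConnected (interior (c i ∪ c j))) a i →
      ¬ Relation.ReflTransGen
      (fun i j => i ∈ P ∧ j ∈ P ∧ IsConnected (interior (c i ∪ c j))) a j →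
      ¬ IsConnected (interior (c i ∪ c j)) := fun i hi j hj hai haj hij =>
    haj (hai.tail ⟨hi, hj, hij⟩)
  have haa : Relation.ReflTransGen
      (fun i j => i ∈ P ∧ j ∈ P ∧ IsConnected (interior (c i ∪ c j))) a a := .refl
  generalize Relation.ReflTransGen
    (fun i j => i ∈ P ∧ j ∈ P ∧ IsConnected (interior (c i ∪ c j))) a = R at hab hR haa
  let g : (ι → Prop) → Set (Pt d) := fun S =>
    ⋃ i ∈ {i | i ∈ P ∧ S i}, ⋃ j ∈ {j | j ∈ P ∧ S j}, interior (c i ∪ c j)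
  have hgo : ∀ S, IsOpen (g S) := fun S =>
    isOpen_biUnion fun i _ => isOpen_biUnion fun j _ => isOpen_interior
  have hg : ∀ (S : ι → Prop) i, i ∈ P → S i → ∀ j, j ∈ P → S j → interior (c i ∪ c j) ⊆ g S :=
    fun S i hi hSi j hj hSj => subset_iUnion₂_of_subset i ⟨hi, hSi⟩
      (subset_iUnion₂_of_subset j ⟨hj, hSj⟩ Subset.rfl)
  have hself : ∀ (S : ι → Prop) i, i ∈ P → S i → interior (c i) ⊆ g S := fun S i hi hSi => by
    simpa using hg S i hi hSi i hi hSi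
  have hmem : ∀ i ∈ P, ∀ S : ι → Prop, S i →
      ((⋃ i ∈ P, ⋃ j ∈ P, interior (c i ∪ c j)) ∩ g S).Nonempty := by
    intro i hi S hS
    obtain ⟨x, hx⟩ := (hball i hi).isConnected_interior.nonempty
    refine ⟨x, mem_iUnion₂.2 ⟨i, hi, mem_iUnion₂.2 ⟨i, hi, ?_⟩⟩, hself S i hi hS hx⟩
    rwa [union_self]
  obtain ⟨x, -, hx, hx'⟩ := hpre (g R) (g fun i => ¬ R i) (hgo _) (hgo _) (by
      refine iUnion₂_subset fun i hi => iUnion₂_subset fun j hj => ?_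
      by_cases hRi : R i <;> by_cases hRj : R j
      · exact (hg R i hi hRi j hj hRj).trans subset_union_left
      · exact (interior_union_subset_of_not_isConnected (hball i hi) (hball j hj)
          (hR i hi j hj hRi hRj)).trans
          (union_subset_union (hself R i hi hRi) (hself _ j hj hRj))
      · rw [union_comm (c i)]
        exact (interior_union_subset_of_not_isConnected (hball j hj) (hball i hi)
          (hR j hj i hi hRj hRi)).trans
          (union_subset_union (hself R j hj hRj) (hself _ i hi hRi))
      · exact (hg (fun i => ¬ R i) i hi hRi j hj hRj).trans subset_union_right)
    (hmem a ha R haa) (hmem b hb _ hab)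
  simp only [g, mem_iUnion] at hx hx'
  obtain ⟨i, ⟨hi, hRi⟩, j, ⟨hj, hRj⟩, hx⟩ := hx
  obtain ⟨k, ⟨hk, hRk⟩, l, ⟨hl, hRl⟩, hx'⟩ := hx'
  have hne : ∀ m n, R m → ¬ R n → m ≠ n := fun m n hm hn h => hn (h ▸ hm)
  have hD : ∀ m n, m ∈ P → n ∈ P → R m → ¬ R n → Disjoint (c m) (interior (c n)) :=
    fun m n hm hn hRm hRn => (hball m hm).disjoint_interior (hdis m hm n hn (hne m n hRm hRn))
  have hcl : ∀ n ∈ P, ¬ R n → Disjoint (interior (c i ∪ c j)) (c n) := fun n hn hRn =>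
    (((disjoint_union_left.2 ⟨hD i n hi hn hRi hRn, hD j n hj hn hRj hRn⟩).mono_left
      interior_subset).closure_right isOpen_interior).mono_right (hball n hn).subset_closure_interior
  exact (interior_subset hx').elim (disjoint_left.1 (hcl k hk hRk) hx)
    (disjoint_left.1 (hcl l hl hRl) hx)

theorem Tile.translate_translate {d : ℕ} (t : Tile d) (x y : Pt d) :
    (t.translate x).translate y = t.translate (x + y) := by
  simp only [Tile.translate, image_image, add_assoc]

theorem Tile.translate_zero {d : ℕ} (t : Tile d) : t.translate 0 = t := by
  simp [Tile.translate]

theorem translateSet_translateSet {d : ℕ} (P : Set (Tile d)) (x y : Pt d) :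
    translateSet (translateSet P x) y = translateSet P (x + y) := by
  simp [translateSet, image_image, Tile.translate_translate]

theorem translateSet_zero {d : ℕ} (P : Set (Tile d)) : translateSet P 0 = P := by
  simp [translateSet, Tile.translate_zero]

theorem translateSet_mono {d : ℕ} {P Q : Set (Tile d)} (h : P ⊆ Q) (x : Pt d) :
    translateSet P x ⊆ translateSet Q x := image_mono h

theorem translateSet_subset_translateSet_iff {d : ℕ} {P Q : Set (Tile d)} {x y : Pt d} :
    translateSet P x ⊆ translateSet Q y ↔ translateSet P (x - y) ⊆ Q := by
  constructor
  · intro h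
    have := translateSet_mono h (-y)
    rwa [translateSet_translateSet, translateSet_translateSet, add_neg_cancel, translateSet_zero,
      ← sub_eq_add_neg] at this
  · intro h
    have := translateSet_mono h y
    rwa [translateSet_translateSet, sub_add_cancel] at this

theorem Tile.carrier_translate {d : ℕ} (t : Tile d) (x : Pt d) :
    (t.translate x).carrier = Homeomorph.addRight x '' t.carrier := rfl

theorem Tile.IsTile.translate {d : ℕ} {t : Tile d} (ht : t.IsTile) (x : Pt d) :
    (t.translate x).IsTile :=
  ht.map fun e => ((Homeomorph.addRight x).image t.carrier).symm.trans e

theorem IsPartialTiling.translateSet {d : ℕ} {P : Set (Tile d)} (hP : IsPartialTiling P)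
    (x : Pt d) : IsPartialTiling (translateSet P x) := by
  refine ⟨?_, ?_⟩
  · rintro _ ⟨t, ht, rfl⟩
    exact (hP.1 t ht).translate x
  · rintro _ ⟨t, ht, rfl⟩ _ ⟨t', ht', rfl⟩ hne
    simp only [Tile.carrier_translate]
    rw [← Homeomorph.image_interior, ← Homeomorph.image_interior,
      ← image_inter (Homeomorph.injective _),
      hP.2 t ht t' ht' (fun h => hne (by rw [h])), image_empty]

theorem IsPartialTiling.mono {d : ℕ} {P Q : Set (Tile d)} (hQ : IsPartialTiling Q) (h : P ⊆ Q) :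
    IsPartialTiling P :=
  ⟨fun t ht => hQ.1 t (h ht), fun t ht t' ht' => hQ.2 t (h ht) t' (h ht')⟩

theorem psupp_translateSet {d : ℕ} (P : Set (Tile d)) (x : Pt d) :
    psupp (translateSet P x) = Homeomorph.addRight x '' psupp P := by
  simp only [psupp, translateSet, biUnion_image, image_iUnion₂, Tile.carrier_translate]

namespace SubstSystem

variable {d : ℕ} (S : SubstSystem d)

theorem translateSet_mem_Omega {T : Set (Tile d)} (hT : T ∈ S.Omega) (x : Pt d) :
    translateSet T x ∈ S.Omega := by
  refine ⟨⟨hT.1.1.translateSet x, ?_⟩, fun P hPT hP => ?_⟩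
  · rw [psupp_translateSet, hT.1.2, image_univ, (Homeomorph.addRight x).range_coe]
  · obtain ⟨n, p, hp, y, hy⟩ := hT.2 (translateSet P (-x)) (by
      rw [← zero_sub, ← translateSet_subset_translateSet_iff, translateSet_zero]
      exact hPT) ⟨hP.1.translateSet _, hP.2.image _⟩
    refine ⟨n, p, hp, y + x, ?_⟩
    have := translateSet_mono hy x
    rwa [translateSet_translateSet, translateSet_translateSet, neg_add_cancel,
      translateSet_zero] at this

theorem exists_isPuncture_of_mem_omegan {p : Tile d} (hp : p ∈ S.proto) (n : ℕ) :
    ∀ t ∈ S.omegan n p, ∃ x, S.IsPuncture t x := by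
  induction n with
  | zero =>
    intro t ht
    simp only [omegan, subIter, Function.iterate_zero, id_eq, mem_singleton_iff] at ht
    exact ⟨0, p, hp, by rw [ht, Tile.translate_zero]⟩
  | succ n ih =>
    intro t ht
    simp only [omegan, subIter, Function.iterate_succ_apply'] at ht
    obtain ⟨s, hs, hts⟩ := mem_iUnion₂.1 ht
    obtain ⟨x, q, hq, rfl⟩ := ih s hs
    rw [S.sub_translate] at hts
    obtain ⟨t', ht', rfl⟩ := hts
    obtain ⟨q', hq', y, rfl⟩ := S.sub_proto q hq t' ht'
    exact ⟨_, q', hq', Tile.translate_translate _ _ _⟩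

theorem isPuncture_punc {T : Set (Tile d)} (hT : T ∈ S.Omega) {t : Tile d} (ht : t ∈ T) :
    S.IsPuncture t (S.punc t) := by
  have hex : ∃ x, S.IsPuncture t x := by
    obtain ⟨n, p, hp, x, hx⟩ := hT.2 {t} (singleton_subset_iff.2 ht)
      ⟨hT.1.1.mono (singleton_subset_iff.2 ht), finite_singleton t⟩
    obtain ⟨s, hs, rfl⟩ := hx rfl
    obtain ⟨y, q, hq, rfl⟩ := S.exists_isPuncture_of_mem_omegan hp n s hs
    exact ⟨_, q, hq, Tile.translate_translate _ _ _⟩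
  rw [punc, dif_pos hex]
  exact hex.choose_spec

theorem relComp_Vset {T₀ : Set (Tile d)} (hT₀ : T₀ ∈ S.Omega) {Q : Set (Tile d)} {t a : Tile d}
    (haT : a ∈ T₀) (b : Tile d) :
    relComp (S.Vset Q t a) (S.Vset {a, b} a b) = S.Vset (Q ∪ {a, b}) t b := by
  have hsub : ∀ T : Set (Tile d), translateSet (Q ∪ {a, b}) (-S.punc t) ⊆ T ↔
      translateSet Q (-S.punc t) ⊆ T ∧
      translateSet {a, b} (-S.punc a) ⊆ translateSet T (S.punc t - S.punc a) := by
    intro T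
    rw [translateSet_subset_translateSet_iff, show -S.punc a - (S.punc t - S.punc a) = -S.punc t by
      abel, translateSet, image_union, union_subset_iff]
    rfl
  have htr : ∀ T : Set (Tile d), translateSet (translateSet T (S.punc t - S.punc a))
      (S.punc a - S.punc b) = translateSet T (S.punc t - S.punc b) := by
    intro T
    rw [translateSet_translateSet, sub_add_sub_cancel]
  ext ⟨T, T''⟩
  constructor
  · rintro ⟨z, ⟨⟨hT, hQT⟩, hz⟩, ⟨-, hab⟩, hT''⟩
    simp only at hT hQT hz hab hT''
    subst hz
    exact ⟨⟨hT, (hsub T).2 ⟨hQT, hab⟩⟩, hT''.trans (htr T)⟩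
  · rintro ⟨⟨hT, hQT⟩, hT''⟩
    simp only at hT hQT hT''
    obtain ⟨hQT, hab⟩ := (hsub T).1 hQT
    refine ⟨translateSet T (S.punc t - S.punc a), ⟨⟨hT, hQT⟩, rfl⟩,
      ⟨⟨S.translateSet_mem_Omega hT.1 _, a.translate (-S.punc a), ?_, ?_⟩, hab⟩,
      hT''.trans (htr T).symm⟩
    · exact hab ⟨a, mem_insert _ _, rfl⟩
    · obtain ⟨p, hp, hap⟩ := S.isPuncture_punc hT₀ haT
      refine ⟨p, hp, ?_⟩
      have h := congrArg (Tile.translate · (-S.punc a)) hap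
      simpa only [Tile.translate_translate, add_neg_cancel] using h

end SubstSystem

theorem Tile.IsTile.isEmbeddedBall {d : ℕ} {t : Tile d} (ht : t.IsTile) :
    IsEmbeddedBall t.carrier :=
  ht.elim exists_injOn_closedBall_of_homeomorph

theorem reflTransGen_adjacent {d : ℕ} {P : Set (Tile d)} (hP : IsPatch P)
    (hconn : IsConnected (interior (psupp P))) {a b : Tile d} (ha : a ∈ P) (hb : b ∈ P) :
    Relation.ReflTransGen
      (fun s s' => s ∈ P ∧ s' ∈ P ∧ IsConnected (interior (s.carrier ∪ s'.carrier))) a b := by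
  have h := reflTransGen_of_isPreconnected_interior_biUnion (P := hP.2.toFinset)
    (c := Tile.carrier) (a := a) (b := b)
  simp only [Finite.mem_toFinset] at h
  exact h (fun i hi => (hP.1.1 i hi).isEmbeddedBall)
    (fun i hi j hj hij => disjoint_iff_inter_eq_empty.2 (hP.1.2 i hi j hj hij))
    hconn.isPreconnected ha hb

/-- `R` is a composition of relations `V({s, s'}, s, s')` for adjacent tiles of `P`. -/
def IsAdjacentComp {d : ℕ} (S : SubstSystem d) (P : Set (Tile d))
    (R : Set (Set (Tile d) × Set (Tile d))) : Prop :=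
  ∃ (R₀ : Set (Set (Tile d) × Set (Tile d))) (L : List (Set (Set (Tile d) × Set (Tile d)))),
    (∀ R ∈ R₀ :: L, ∃ s s' : Tile d, s ∈ P ∧ s' ∈ P ∧
      IsConnected (interior (s.carrier ∪ s'.carrier)) ∧
      (R = S.Vset {s, s'} s s' ∨ R = relTrans (S.Vset {s, s'} s s'))) ∧
    R = L.foldl relComp R₀

theorem IsAdjacentComp.exists_of_reflTransGen {d : ℕ} {S : SubstSystem d} {P T : Set (Tile d)}
    (hT : T ∈ S.Omega) (hPT : P ⊆ T) {Q : Set (Tile d)} {t a b : Tile d} (hQP : Q ⊆ P)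
    (ha : a ∈ Q) (hQ : IsAdjacentComp S P (S.Vset Q t a))
    (hab : Relation.ReflTransGen
      (fun s s' => s ∈ P ∧ s' ∈ P ∧ IsConnected (interior (s.carrier ∪ s'.carrier))) a b) :
    ∃ Q', Q ⊆ Q' ∧ Q' ⊆ P ∧ b ∈ Q' ∧ IsAdjacentComp S P (S.Vset Q' t b) := by
  induction hab with
  | refl => exact ⟨Q, Subset.rfl, hQP, ha, hQ⟩
  | @tail b c _ hbc ih =>
    obtain ⟨Q', hQQ', hQ'P, -, R₀, L, hL, heq⟩ := ih
    refine ⟨Q' ∪ {b, c}, hQQ'.trans subset_union_left, union_subset hQ'P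
      (insert_subset hbc.1 (singleton_subset_iff.2 hbc.2.1)), Or.inr (Or.inr rfl), R₀,
      L ++ [S.Vset {b, c} b c], ?_, ?_⟩
    · intro R hR
      rw [← List.cons_append, List.mem_append, List.mem_singleton] at hR
      rcases hR with hR | rfl
      · exact hL R hR
      · exact ⟨b, c, hbc.1, hbc.2.1, hbc.2.2, Or.inl rfl⟩
    · rw [List.foldl_append, ← heq, List.foldl_cons, List.foldl_nil,
        S.relComp_Vset hT (hPT hbc.1)]

/-- Lemma 4.2: For a connected patch `P` and `t₁, t₂ ∈ P`,
`V(P, t₁, t₂)` is a finite composition of relations of the form `V({s, s'}, s, s')`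
for adjacent pairs `s, s' ∈ P`, together with their transposes. -/
theorem stmt9 {d : ℕ} (hd : 1 ≤ d) (S : SubstSystem d)
    (P : Set (Tile d)) (hP : IsPatch P) (hPT : ∃ T ∈ S.Omega, P ⊆ T)
    (hconn : IsConnected (interior (psupp P)))
    (t₁ : Tile d) (ht₁ : t₁ ∈ P) (t₂ : Tile d) (ht₂ : t₂ ∈ P) :
    ∃ (R₀ : Set (Set (Tile d) × Set (Tile d)))
      (L : List (Set (Set (Tile d) × Set (Tile d)))),
      (∀ R ∈ R₀ :: L, ∃ s s' : Tile d, s ∈ P ∧ s' ∈ P ∧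
        IsConnected (interior (s.carrier ∪ s'.carrier)) ∧
        (R = S.Vset {s, s'} s s' ∨ R = relTrans (S.Vset {s, s'} s s'))) ∧
      S.Vset P t₁ t₂ = L.foldl relComp R₀ := by
  obtain ⟨T, hT, hPT⟩ := hPT
  have hfin : ∀ F : Set (Tile d), F.Finite → F ⊆ P → ∃ Q b, F ⊆ Q ∧ Q ⊆ P ∧ b ∈ Q ∧
      IsAdjacentComp S P (S.Vset Q t₁ b) := by
    intro F hF
    induction F, hF using Set.Finite.induction_on with
    | empty =>
      refine fun _ => ⟨{t₁, t₁}, t₁, empty_subset _, by simpa using ht₁, mem_insert _ _,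
        S.Vset {t₁, t₁} t₁ t₁, [], ?_, rfl⟩
      intro R hR
      rw [List.mem_singleton] at hR
      refine ⟨t₁, t₁, ht₁, ht₁, ?_, Or.inl hR⟩
      rw [union_self]
      exact (hP.1.1 t₁ ht₁).isEmbeddedBall.isConnected_interior
    | @insert a F _ _ ih =>
      intro hFP
      obtain ⟨Q, b, hFQ, hQP, hbQ, hQ⟩ := ih ((subset_insert _ _).trans hFP)
      obtain ⟨Q', hQQ', hQ'P, haQ', hQ'⟩ := hQ.exists_of_reflTransGen hT hPT hQP hbQ
        (reflTransGen_adjacent hP hconn (hQP hbQ) (hFP (mem_insert _ _)))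
      exact ⟨Q', a, insert_subset haQ' (hFQ.trans hQQ'), hQ'P, haQ', hQ'⟩
  obtain ⟨Q, b, hPQ, hQP, hbQ, hQ⟩ := hfin P hP.2 Subset.rfl
  obtain ⟨Q', hQQ', hQ'P, -, hQ'⟩ := hQ.exists_of_reflTransGen hT hPT hQP hbQ
    (reflTransGen_adjacent hP hconn (hQP hbQ) ht₂)
  rwa [hQ'P.antisymm (hPQ.trans hQQ')] at hQ'
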